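/- arXiv:1711.08871 — 6 statements merged into one kernel-verified Lean document; each statement's English description precedes it below -/
import Mathlib

section
/- There exists a holomorphic function w₃ defined on the half-plane {z ∈ ℂ : Im z > 2√2·σ₁} such that for every z in this half-plane, Im w₃(z) > (3/4)·Im z and T_z(w₃(z)) = w₃(z); i.e. the map assigning to each z the unique fixed point of T_z in {Im w > (3/4)·Im z} is holomorphic. -/
open MeasureTheory Filter

/-- The Cauchy transform `G_μ(z) = ∫ (z - t)⁻¹ dμ(t)` of a measure on `ℝ`. -/
noncomputable def cauchyG (μ : Measure ℝ) (z : ℂ) : ℂ := ∫ t, (z - (t : ℂ))⁻¹ ∂μ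

/-- The reciprocal Cauchy transform `F_μ(z) = 1/G_μ(z)`. -/
noncomputable def cauchyF (μ : Measure ℝ) (z : ℂ) : ℂ := (cauchyG μ z)⁻¹

/-- `h_μ(z) = z - F_μ(z)`. -/
noncomputable def hTrans (μ : Measure ℝ) (z : ℂ) : ℂ := z - cauchyF μ z

/-- The fixed point map `T_z(w) = h_{μ₁}(F_{μ₃}(w) + w - z) + z` of the additive
free deconvolution. -/
noncomputable def Tadd (μ₁ μ₃ : Measure ℝ) (z w : ℂ) : ℂ :=
  hTrans μ₁ (cauchyF μ₃ w + w - z) + z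


lemma le_of_sq_le_sq_aux {a b : ℝ} (h : a ^ 2 ≤ b ^ 2) (hb : 0 ≤ b) : a ≤ b :=
  (abs_le_of_sq_le_sq' h hb).2

lemma sub_ne' {z : ℂ} (hz : 0 < z.im) (t : ℝ) : z - (t : ℂ) ≠ 0 := by
  intro h
  have := congrArg Complex.im h
  simp at this
  linarith

lemma norm_r_le {z : ℂ} (hz : 0 < z.im) (t : ℝ) : ‖(z - (t : ℂ))⁻¹‖ ≤ z.im⁻¹ := by
  rw [norm_inv]
  apply inv_anti₀ hz
  have := Complex.abs_im_le_norm (z - (t : ℂ))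
  simp at this
  exact (le_abs_self _).trans this

lemma cont_r {z : ℂ} (hz : 0 < z.im) : Continuous (fun t : ℝ => (z - (t : ℂ))⁻¹) := by
  apply Continuous.inv₀
  · fun_prop
  · exact sub_ne' hz

lemma memLp_r (μ : Measure ℝ) [IsProbabilityMeasure μ] {z : ℂ} (hz : 0 < z.im) (p : ENNReal) :
    MemLp (fun t : ℝ => (z - (t : ℂ))⁻¹) p μ :=
  MemLp.of_bound (cont_r hz).aestronglyMeasurable z.im⁻¹ (Eventually.of_forall (norm_r_le hz))

lemma cs {μ : Measure ℝ} {f g : ℝ → ℂ} (hf : MemLp f 2 μ) (hg : MemLp g 2 μ) :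
    ‖∫ t, f t * g t ∂μ‖ ^ 2 ≤ (∫ t, ‖f t‖ ^ 2 ∂μ) * (∫ t, ‖g t‖ ^ 2 ∂μ) := by
  have h1 : ‖∫ t, f t * g t ∂μ‖ ≤ ∫ t, ‖f t‖ * ‖g t‖ ∂μ := by
    refine (norm_integral_le_integral_norm _).trans (le_of_eq ?_)
    simp only [norm_mul]
  have h2 := integral_mul_norm_le_Lp_mul_Lq (μ := μ) (f := f) (g := g) (p := 2) (q := 2)
    (by constructor <;> norm_num) (by simpa using hf) (by simpa using hg)
  have hF : 0 ≤ ∫ t, ‖f t‖ ^ 2 ∂μ := integral_nonneg fun _ => by positivity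
  have hG : 0 ≤ ∫ t, ‖g t‖ ^ 2 ∂μ := integral_nonneg fun _ => by positivity
  simp only [Real.rpow_two, ← Real.sqrt_eq_rpow] at h2
  have h3 := h1.trans h2
  calc _ ≤ (√(∫ t, ‖f t‖ ^ 2 ∂μ) * √(∫ t, ‖g t‖ ^ 2 ∂μ)) ^ 2 := by gcongr
    _ = _ := by rw [mul_pow, Real.sq_sqrt hF, Real.sq_sqrt hG]

/-- second absolute moment of the resolvent -/
noncomputable def SS (μ : Measure ℝ) (z : ℂ) : ℝ := ∫ t, ‖(z - (t : ℂ))⁻¹‖ ^ 2 ∂μ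

/-- the ratio -/
noncomputable def kk (μ : Measure ℝ) (z : ℂ) : ℝ := SS μ z / ‖cauchyG μ z‖ ^ 2

lemma imG (μ : Measure ℝ) [IsProbabilityMeasure μ] {z : ℂ} (hz : 0 < z.im) :
    (cauchyG μ z).im = - (z.im * SS μ z) := by
  have hi : Integrable (fun t : ℝ => (z - (t : ℂ))⁻¹) μ := memLp_one_iff_integrable.1 (memLp_r μ hz 1)
  have := integral_im (𝕜 := ℂ) hi
  simp only [RCLike.im_to_complex] at this
  rw [cauchyG, ← this, SS, ← integral_const_mul, ← integral_neg]
  congr 1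
  ext t
  rw [Complex.inv_im, norm_inv, inv_pow, Complex.normSq_eq_norm_sq]
  simp
  ring

lemma SS_pos (μ : Measure ℝ) [IsProbabilityMeasure μ] {z : ℂ} (hz : 0 < z.im) : 0 < SS μ z := by
  unfold SS
  rw [integral_pos_iff_support_of_nonneg (fun _ => by positivity) (memLp_r μ hz 2).norm.integrable_sq]
  have : Function.support (fun t : ℝ => ‖(z - (t : ℂ))⁻¹‖ ^ 2) = Set.univ := by
    ext t
    simp only [Function.mem_support, Set.mem_univ, iff_true]
    exact pow_ne_zero _ (norm_ne_zero_iff.2 (inv_ne_zero (sub_ne' hz t)))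
  rw [this]; simp

lemma G_ne (μ : Measure ℝ) [IsProbabilityMeasure μ] {z : ℂ} (hz : 0 < z.im) : cauchyG μ z ≠ 0 := by
  intro h
  have := imG μ hz
  rw [h] at this
  have h2 := mul_pos hz (SS_pos μ hz)
  rw [Complex.zero_im] at this
  linarith

lemma imF (μ : Measure ℝ) [IsProbabilityMeasure μ] {z : ℂ} (hz : 0 < z.im) :
    (cauchyF μ z).im = z.im * kk μ z := by
  rw [cauchyF, Complex.inv_im, imG μ hz, Complex.normSq_eq_norm_sq, kk]
  ring

lemma var_r (μ : Measure ℝ) [IsProbabilityMeasure μ] {z : ℂ} (hz : 0 < z.im) :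
    ∫ t, ‖(z - (t : ℂ))⁻¹ - cauchyG μ z‖ ^ 2 ∂μ = ‖cauchyG μ z‖ ^ 2 * (kk μ z - 1) := by
  have hi : Integrable (fun t : ℝ => (z - (t : ℂ))⁻¹) μ := memLp_one_iff_integrable.1 (memLp_r μ hz 1)
  set G := cauchyG μ z with hG
  have e : ∀ t : ℝ, ‖(z - (t : ℂ))⁻¹ - G‖ ^ 2 =
      ‖(z - (t : ℂ))⁻¹‖ ^ 2 + ‖G‖ ^ 2 - 2 * ((z - (t : ℂ))⁻¹ * (starRingEnd ℂ) G).re := by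
    intro t
    rw [← Complex.normSq_eq_norm_sq, Complex.normSq_sub, Complex.normSq_eq_norm_sq,
      Complex.normSq_eq_norm_sq]
  have hi2 := hi.mul_const ((starRingEnd ℂ) G)
  have := integral_re (𝕜 := ℂ) hi2
  simp only [RCLike.re_to_complex] at this
  have hre : Integrable (fun t : ℝ => ((z - (t : ℂ))⁻¹ * (starRingEnd ℂ) G).re) μ := hi2.re
  simp_rw [e]
  have j1 : Integrable (fun t : ℝ => ‖(z - (t : ℂ))⁻¹‖ ^ 2) μ := (memLp_r μ hz 2).norm.integrable_sq
  have j2 : Integrable (fun t : ℝ => ‖(z - (t : ℂ))⁻¹‖ ^ 2 + ‖G‖ ^ 2) μ :=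
    j1.add (integrable_const _)
  rw [integral_sub j2 (hre.const_mul 2), integral_add j1 (integrable_const _), integral_const_mul,
    this, integral_mul_const]
  change SS μ z + _ - 2 * (G * _).re = _
  rw [Complex.mul_conj, kk, ← hG, Complex.normSq_eq_norm_sq]
  have : ‖G‖ ^ 2 ≠ 0 := by have := G_ne μ hz; positivity
  simp only [integral_const, probReal_univ, smul_eq_mul, one_mul, Complex.ofReal_re]
  rw [mul_sub, mul_div_cancel₀ _ this]
  ring

lemma one_le_kk (μ : Measure ℝ) [IsProbabilityMeasure μ] {z : ℂ} (hz : 0 < z.im) :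
    1 ≤ kk μ z := by
  have h := var_r μ hz
  have h0 : 0 ≤ ∫ t, ‖(z - (t : ℂ))⁻¹ - cauchyG μ z‖ ^ 2 ∂μ := integral_nonneg fun _ => by positivity
  have : 0 < ‖cauchyG μ z‖ ^ 2 := by have := G_ne μ hz; positivity
  rw [h] at h0
  have := nonneg_of_mul_nonneg_right h0 this
  linarith

lemma F_sub (μ : Measure ℝ) [IsProbabilityMeasure μ] {a b : ℂ} (ha : 0 < a.im) (hb : 0 < b.im) :
    cauchyF μ a - cauchyF μ b = (a - b) * (∫ t, (a - (t : ℂ))⁻¹ * (b - (t : ℂ))⁻¹ ∂μ) /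
      (cauchyG μ a * cauchyG μ b) := by
  have hia : Integrable (fun t : ℝ => (a - (t : ℂ))⁻¹) μ := memLp_one_iff_integrable.1 (memLp_r μ ha 1)
  have hib : Integrable (fun t : ℝ => (b - (t : ℂ))⁻¹) μ := memLp_one_iff_integrable.1 (memLp_r μ hb 1)
  have h1 : cauchyG μ b - cauchyG μ a =
      (a - b) * (∫ t, (a - (t : ℂ))⁻¹ * (b - (t : ℂ))⁻¹ ∂μ) := by
    rw [cauchyG, cauchyG, ← integral_sub hib hia, ← integral_const_mul]
    congr 1
    ext t
    have := sub_ne' ha t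
    have := sub_ne' hb t
    field_simp
    ring
  rw [← h1, cauchyF, cauchyF]
  have := G_ne μ ha
  have := G_ne μ hb
  field_simp

lemma F_lip (μ : Measure ℝ) [IsProbabilityMeasure μ] {a b : ℂ} (ha : 0 < a.im) (hb : 0 < b.im) :
    ‖cauchyF μ a - cauchyF μ b‖ ^ 2 ≤ ‖a - b‖ ^ 2 * (kk μ a * kk μ b) := by
  rw [F_sub μ ha hb]
  have h := cs (memLp_r μ ha 2) (memLp_r μ hb 2)
  have := G_ne μ ha
  have := G_ne μ hb
  rw [norm_div, norm_mul, norm_mul, div_pow, mul_pow, mul_pow, kk, kk, mul_div_assoc,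
    div_mul_div_comm]
  unfold SS
  gcongr

lemma h_lip (μ : Measure ℝ) [IsProbabilityMeasure μ] {a b : ℂ} (ha : 0 < a.im) (hb : 0 < b.im) :
    ‖hTrans μ a - hTrans μ b‖ ^ 2 ≤ ‖a - b‖ ^ 2 * ((kk μ a - 1) * (kk μ b - 1)) := by
  have h := cs ((memLp_r μ ha 2).sub (memLp_const (cauchyG μ a)))
    ((memLp_r μ hb 2).sub (memLp_const (cauchyG μ b)))
  simp only [Pi.sub_apply] at h
  rw [var_r μ ha, var_r μ hb] at h
  have hia : Integrable (fun t : ℝ => (a - (t : ℂ))⁻¹) μ := memLp_one_iff_integrable.1 (memLp_r μ ha 1)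
  have hib : Integrable (fun t : ℝ => (b - (t : ℂ))⁻¹) μ := memLp_one_iff_integrable.1 (memLp_r μ hb 1)
  have hab : Integrable (fun t : ℝ => (a - (t : ℂ))⁻¹ * (b - (t : ℂ))⁻¹) μ :=
    (memLp_r μ ha 2).integrable_mul (memLp_r μ hb 2)
  have e : ∫ t, ((a - (t : ℂ))⁻¹ - cauchyG μ a) * ((b - (t : ℂ))⁻¹ - cauchyG μ b) ∂μ =
      (∫ t, (a - (t : ℂ))⁻¹ * (b - (t : ℂ))⁻¹ ∂μ) - cauchyG μ a * cauchyG μ b := by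
    have e1 : ∀ t : ℝ, ((a - (t : ℂ))⁻¹ - cauchyG μ a) * ((b - (t : ℂ))⁻¹ - cauchyG μ b) =
      (a - (t : ℂ))⁻¹ * (b - (t : ℂ))⁻¹ - cauchyG μ a * (b - (t : ℂ))⁻¹ -
        (a - (t : ℂ))⁻¹ * cauchyG μ b + cauchyG μ a * cauchyG μ b := fun t => by ring
    simp_rw [e1]
    have j1 : Integrable (fun t : ℝ => (a - (t : ℂ))⁻¹ * (b - (t : ℂ))⁻¹ -
        cauchyG μ a * (b - (t : ℂ))⁻¹) μ := hab.sub (hib.const_mul _)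
    have j2 : Integrable (fun t : ℝ => (a - (t : ℂ))⁻¹ * (b - (t : ℂ))⁻¹ -
        cauchyG μ a * (b - (t : ℂ))⁻¹ - (a - (t : ℂ))⁻¹ * cauchyG μ b) μ :=
      j1.sub (hia.mul_const _)
    rw [integral_add j2 (integrable_const _), integral_sub j1 (hia.mul_const _),
      integral_sub hab (hib.const_mul _), integral_const_mul, integral_mul_const]
    change _ - cauchyG μ a * cauchyG μ b - cauchyG μ a * cauchyG μ b + _ = _
    simp
  rw [e] at h
  have h1 := G_ne μ ha
  have h2 := G_ne μ hb
  have e2 : hTrans μ a - hTrans μ b = - ((a - b) *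
      ((∫ t, (a - (t : ℂ))⁻¹ * (b - (t : ℂ))⁻¹ ∂μ) - cauchyG μ a * cauchyG μ b) /
      (cauchyG μ a * cauchyG μ b)) := by
    have := F_sub μ ha hb
    have e3 : hTrans μ a - hTrans μ b = (a - b) - (cauchyF μ a - cauchyF μ b) := by
      unfold hTrans; ring
    rw [e3, this]
    field_simp
    ring
  rw [e2, norm_neg, norm_div, norm_mul, norm_mul, div_pow, mul_pow, mul_pow,
    div_le_iff₀ (by positivity)]
  calc _ ≤ ‖a - b‖ ^ 2 * _ := mul_le_mul_of_nonneg_left h (by positivity)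
    _ = _ := by ring

lemma h_sq (μ : Measure ℝ) [IsProbabilityMeasure μ]
    (hmom : Integrable (fun t : ℝ => t ^ 2) μ) (σ : ℝ) (hmean : (∫ t, t ∂μ) = 0)
    (hvar : (∫ t, t ^ 2 ∂μ) = σ ^ 2) {z : ℂ} (hz : 0 < z.im) :
    ‖hTrans μ z‖ ^ 2 ≤ σ ^ 2 * (kk μ z - 1) := by
  have hm : MemLp (fun t : ℝ => (t : ℂ)) 2 μ := by
    rw [memLp_two_iff_integrable_sq_norm (by fun_prop)]
    simpa using hmom
  have h := cs hm ((memLp_r μ hz 2).sub (memLp_const (cauchyG μ z)))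
  simp only [Pi.sub_apply] at h
  rw [var_r μ hz] at h
  have hi : Integrable (fun t : ℝ => (z - (t : ℂ))⁻¹) μ := memLp_one_iff_integrable.1 (memLp_r μ hz 1)
  have hit : Integrable (fun t : ℝ => (t : ℂ)) μ := hm.integrable (by norm_num)
  have hG := G_ne μ hz
  have e : ∫ t, (t : ℂ) * ((z - (t : ℂ))⁻¹ - cauchyG μ z) ∂μ = z * cauchyG μ z - 1 := by
    have e1 : ∀ t : ℝ, (t : ℂ) * ((z - (t : ℂ))⁻¹ - cauchyG μ z) =
        z * (z - (t : ℂ))⁻¹ - 1 - (t : ℂ) * cauchyG μ z := by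
      intro t
      have := sub_ne' hz t
      field_simp
      ring
    simp_rw [e1]
    have j1 : Integrable (fun t : ℝ => z * (z - (t : ℂ))⁻¹ - 1) μ :=
      (hi.const_mul z).sub (integrable_const _)
    rw [integral_sub j1 (hit.mul_const _),
      integral_sub (hi.const_mul _) (integrable_const _), integral_const_mul, integral_mul_const,
      integral_complex_ofReal, hmean]
    simp [cauchyG]
  rw [e] at h
  have e2 : hTrans μ z = (z * cauchyG μ z - 1) / cauchyG μ z := by
    unfold hTrans cauchyF
    field_simp
  have e3 : ∫ t : ℝ, ‖(t : ℂ)‖ ^ 2 ∂μ = σ ^ 2 := by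
    rw [← hvar]; simp
  rw [e3] at h
  rw [e2, norm_div, div_pow, div_le_iff₀ (by positivity)]
  linarith

lemma kk_le (μ : Measure ℝ) [IsProbabilityMeasure μ]
    (hmom : Integrable (fun t : ℝ => t ^ 2) μ) (σ : ℝ) (hmean : (∫ t, t ∂μ) = 0)
    (hvar : (∫ t, t ^ 2 ∂μ) = σ ^ 2) {z : ℂ} (hz : 0 < z.im) :
    kk μ z - 1 ≤ σ ^ 2 / z.im ^ 2 := by
  have h := h_sq μ hmom σ hmean hvar hz
  have h1 := one_le_kk μ hz
  have h2 : (hTrans μ z).im = - (z.im * (kk μ z - 1)) := by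
    rw [hTrans, Complex.sub_im, imF μ hz]; ring
  have h3 := Complex.abs_im_le_norm (hTrans μ z)
  rw [h2, abs_neg, abs_of_nonneg (mul_nonneg hz.le (by linarith))] at h3
  have h4 : (z.im * (kk μ z - 1)) ^ 2 ≤ σ ^ 2 * (kk μ z - 1) :=
    (pow_le_pow_left₀ (mul_nonneg hz.le (by linarith)) h3 2).trans h
  rw [le_div_iff₀ (by positivity)]
  rcases h1.eq_or_lt with h5 | h5
  · rw [← h5]; simp; positivity
  · have : 0 < kk μ z - 1 := by linarith
    refine le_of_mul_le_mul_right ?_ this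
    linarith

lemma h_le (μ : Measure ℝ) [IsProbabilityMeasure μ]
    (hmom : Integrable (fun t : ℝ => t ^ 2) μ) (σ : ℝ) (hmean : (∫ t, t ∂μ) = 0)
    (hvar : (∫ t, t ^ 2 ∂μ) = σ ^ 2) {z : ℂ} (hz : 0 < z.im) :
    ‖hTrans μ z‖ ≤ σ ^ 2 / z.im := by
  have h := h_sq μ hmom σ hmean hvar hz
  have h1 := kk_le μ hmom σ hmean hvar hz
  refine le_of_sq_le_sq_aux ?_ (by positivity)
  calc _ ≤ _ := h
    _ ≤ σ ^ 2 * (σ ^ 2 / z.im ^ 2) := by gcongr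
    _ = _ := by ring

lemma G_diff (μ : Measure ℝ) [IsProbabilityMeasure μ] {z : ℂ} (hz : 0 < z.im) :
    DifferentiableAt ℂ (cauchyG μ) z := by
  have hs : {w : ℂ | z.im / 2 < w.im} ∈ nhds z :=
    (isOpen_lt continuous_const Complex.continuous_im).mem_nhds (by simpa using hz)
  have := hasDerivAt_integral_of_dominated_loc_of_deriv_le (μ := μ) (𝕜 := ℂ)
    (F := fun (w : ℂ) (t : ℝ) => (w - (t : ℂ))⁻¹)
    (F' := fun (w : ℂ) (t : ℝ) => -1 / (w - (t : ℂ)) ^ 2) (x₀ := z)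
    (bound := fun _ => ((z.im / 2)⁻¹) ^ 2) hs ?_ ?_ ?_ ?_ ?_ ?_
  · exact this.2.differentiableAt
  · filter_upwards [hs] with w hw
    exact (cont_r (show 0 < w.im by have hw2 : z.im / 2 < w.im := hw; linarith)).aestronglyMeasurable
  · exact memLp_one_iff_integrable.1 (memLp_r μ hz 1)
  · refine Continuous.aestronglyMeasurable ?_
    refine Continuous.div₀ (by fun_prop) (by fun_prop) fun t => pow_ne_zero _ (sub_ne' hz t)
  · refine Eventually.of_forall fun t w hw => ?_
    have hw' : z.im / 2 < w.im := hw
    have := norm_r_le (by linarith : 0 < w.im) t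
    have h2 : w.im⁻¹ ≤ (z.im / 2)⁻¹ := inv_anti₀ (by linarith) hw'.le
    have e : ‖-1 / (w - (t : ℂ)) ^ 2‖ = ‖(w - (t : ℂ))⁻¹‖ ^ 2 := by simp
    rw [e]
    exact pow_le_pow_left₀ (norm_nonneg _) (this.trans h2) 2
  · exact integrable_const _
  · refine Eventually.of_forall fun t w hw => ?_
    have hw' : z.im / 2 < w.im := hw
    have h0 := sub_ne' (by linarith : 0 < w.im) t
    exact ((hasDerivAt_id w).sub_const (t : ℂ)).inv h0

lemma F_diff (μ : Measure ℝ) [IsProbabilityMeasure μ] {z : ℂ} (hz : 0 < z.im) :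
    DifferentiableAt ℂ (cauchyF μ) z := (G_diff μ hz).inv (G_ne μ hz)

lemma h_diff (μ : Measure ℝ) [IsProbabilityMeasure μ] {z : ℂ} (hz : 0 < z.im) :
    DifferentiableAt ℂ (hTrans μ) z := differentiableAt_id.sub (F_diff μ hz)

lemma im_u (μ : Measure ℝ) [IsProbabilityMeasure μ] {z w : ℂ} (hz : 0 < z.im)
    (hw : 3 / 4 * z.im < w.im) : z.im / 2 < (cauchyF μ w + w - z).im := by
  have h0 : 0 < w.im := by linarith
  have := one_le_kk μ h0
  simp only [Complex.sub_im, Complex.add_im, imF μ h0]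
  nlinarith

lemma T_le (μ₁ μ₃ : Measure ℝ) [IsProbabilityMeasure μ₁] [IsProbabilityMeasure μ₃]
    (hmom : Integrable (fun t : ℝ => t ^ 2) μ₁) (σ : ℝ) (hmean : (∫ t, t ∂μ₁) = 0)
    (hvar : (∫ t, t ^ 2 ∂μ₁) = σ ^ 2) {z w : ℂ} (hz : 0 < z.im)
    (hw : 3 / 4 * z.im < w.im) : ‖Tadd μ₁ μ₃ z w - z‖ ≤ 2 * σ ^ 2 / z.im := by
  have hu := im_u μ₃ hz hw
  have := h_le μ₁ hmom σ hmean hvar (z := cauchyF μ₃ w + w - z) (by linarith)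
  rw [Tadd, add_sub_cancel_right]
  refine this.trans ?_
  rw [div_le_div_iff₀ (by linarith) hz]
  nlinarith [sq_nonneg σ]

lemma T_lip (μ₁ μ₃ : Measure ℝ) [IsProbabilityMeasure μ₁] [IsProbabilityMeasure μ₃]
    (hmom : Integrable (fun t : ℝ => t ^ 2) μ₁) (σ : ℝ) (hmean : (∫ t, t ∂μ₁) = 0)
    (hvar : (∫ t, t ^ 2 ∂μ₁) = σ ^ 2) {z a b : ℂ} (hz : 0 < z.im)
    (ha : 3 / 4 * z.im < a.im) (hb : 3 / 4 * z.im < b.im) :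
    ‖Tadd μ₁ μ₃ z a - Tadd μ₁ μ₃ z b‖ ≤ 8 * σ ^ 2 / z.im ^ 2 * ‖a - b‖ := by
  have key : ∀ c : ℂ, 3 / 4 * z.im < c.im →
      (1 + kk μ₃ c) * (kk μ₁ (cauchyF μ₃ c + c - z) - 1) ≤ 8 * σ ^ 2 / z.im ^ 2 := by
    intro c hc
    have hc0 : 0 < c.im := by linarith
    have hu := im_u μ₃ hz hc
    have h1 := kk_le μ₁ hmom σ hmean hvar (z := cauchyF μ₃ c + c - z) (by linarith)
    have hK := one_le_kk μ₃ hc0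
    have hp : z.im * (3 / 4 * (1 + kk μ₃ c) - 1) ≤ (cauchyF μ₃ c + c - z).im := by
      simp only [Complex.sub_im, Complex.add_im, imF μ₃ hc0]
      nlinarith
    set p := (cauchyF μ₃ c + c - z).im
    set K := kk μ₃ c
    have hp2 : (z.im * (3 / 4 * (1 + K) - 1)) ^ 2 ≤ p ^ 2 :=
      pow_le_pow_left₀ (mul_nonneg hz.le (by linarith)) hp 2
    have hp0 : 0 < p := by linarith
    calc _ ≤ (1 + K) * (σ ^ 2 / p ^ 2) := by gcongr
      _ ≤ _ := by
        rw [← mul_div_assoc, div_le_div_iff₀ (by positivity) (by positivity)]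
        have h3 : (1 + K) * z.im ^ 2 ≤ 8 * p ^ 2 := by
          have h4 : 1 + K ≤ 8 * (3 / 4 * (1 + K) - 1) ^ 2 := by nlinarith
          calc _ ≤ 8 * (3 / 4 * (1 + K) - 1) ^ 2 * z.im ^ 2 := by gcongr
            _ = 8 * (z.im * (3 / 4 * (1 + K) - 1)) ^ 2 := by ring
            _ ≤ _ := by linarith
        nlinarith [mul_le_mul_of_nonneg_right h3 (sq_nonneg σ)]
  have ha0 : 0 < a.im := by linarith
  have hb0 : 0 < b.im := by linarith
  have hua : 0 < (cauchyF μ₃ a + a - z).im := by linarith [im_u μ₃ hz ha]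
  have hub : 0 < (cauchyF μ₃ b + b - z).im := by linarith [im_u μ₃ hz hb]
  have hl := h_lip μ₁ hua hub
  have hF := F_lip μ₃ ha0 hb0
  have hKa := one_le_kk μ₃ ha0
  have hKb := one_le_kk μ₃ hb0
  have hka := one_le_kk μ₁ hua
  have hkb := one_le_kk μ₁ hub
  have ka := key a ha
  have kb := key b hb
  have e1 : (cauchyF μ₃ a + a - z) - (cauchyF μ₃ b + b - z) =
    (cauchyF μ₃ a - cauchyF μ₃ b) + (a - b) := by ring
  have hu : ‖(cauchyF μ₃ a + a - z) - (cauchyF μ₃ b + b - z)‖ ^ 2 ≤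
      ‖a - b‖ ^ 2 * ((1 + kk μ₃ a) * (1 + kk μ₃ b)) := by
    rw [e1]
    have := norm_add_le (cauchyF μ₃ a - cauchyF μ₃ b) (a - b)
    set X := ‖cauchyF μ₃ a - cauchyF μ₃ b‖
    set D := ‖a - b‖
    have hX : 0 ≤ X := norm_nonneg _
    have hD : 0 ≤ D := norm_nonneg _
    set A := kk μ₃ a
    set B := kk μ₃ b
    have h2 : 2 * X * D ≤ D ^ 2 * (A + B) := by
      have h3 : 2 * X ≤ D * (A + B) := by
        refine le_of_sq_le_sq_aux ?_ (mul_nonneg hD (by linarith))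
        nlinarith [mul_nonneg (sq_nonneg D) (sq_nonneg (A - B))]
      nlinarith
    calc _ ≤ (X + D) ^ 2 := by gcongr
      _ ≤ _ := by nlinarith
  have e2 : Tadd μ₁ μ₃ z a - Tadd μ₁ μ₃ z b = hTrans μ₁ (cauchyF μ₃ a + a - z) -
    hTrans μ₁ (cauchyF μ₃ b + b - z) := by unfold Tadd; ring
  rw [e2]
  refine le_of_sq_le_sq_aux ?_ (by positivity)
  refine hl.trans ?_
  set P := kk μ₁ (cauchyF μ₃ a + a - z) - 1
  set Q := kk μ₁ (cauchyF μ₃ b + b - z) - 1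
  have hP : 0 ≤ P := by simp only [P]; linarith
  have hQ : 0 ≤ Q := by simp only [Q]; linarith
  calc _ ≤ ‖a - b‖ ^ 2 * ((1 + kk μ₃ a) * (1 + kk μ₃ b)) * (P * Q) := by gcongr
    _ = ‖a - b‖ ^ 2 * (((1 + kk μ₃ a) * P) * ((1 + kk μ₃ b) * Q)) := by ring
    _ ≤ ‖a - b‖ ^ 2 * ((8 * σ ^ 2 / z.im ^ 2) * (8 * σ ^ 2 / z.im ^ 2)) := by gcongr
    _ = _ := by ring

/-- Picard iterates -/
noncomputable def wit (μ₁ μ₃ : Measure ℝ) : ℕ → ℂ → ℂ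
  | 0, z => z
  | n + 1, z => Tadd μ₁ μ₃ z (wit μ₁ μ₃ n z)

/-- There is a holomorphic function `w₃` on the half-plane
`{z : Im z > 2√2·σ₁}` such that for each `z` there, `Im w₃(z) > (3/4)·Im z` and
`w₃(z)` is a fixed point of `T_z`. -/
theorem subordination_holomorphic (μ₁ μ₃ : Measure ℝ)
    [IsProbabilityMeasure μ₁] [IsProbabilityMeasure μ₃]
    (hμ₁mom : Integrable (fun t : ℝ => t ^ 2) μ₁)
    (hμ₃mom : Integrable (fun t : ℝ => t ^ 2) μ₃)
    (σ₁ : ℝ) (hσ₁ : 0 < σ₁)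
    (hmean₁ : (∫ t, t ∂μ₁) = 0)
    (hvar₁ : (∫ t, t ^ 2 ∂μ₁) = σ₁ ^ 2) :
    ∃ w₃ : ℂ → ℂ,
      DifferentiableOn ℂ w₃ {z : ℂ | 2 * Real.sqrt 2 * σ₁ < z.im} ∧
      ∀ z : ℂ, 2 * Real.sqrt 2 * σ₁ < z.im →
        3 / 4 * z.im < (w₃ z).im ∧ Tadd μ₁ μ₃ z (w₃ z) = w₃ z := by
  set c := 2 * Real.sqrt 2 * σ₁ with hc
  have hc0 : 0 < c := by positivity
  have hc2 : c ^ 2 = 8 * σ₁ ^ 2 := by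
    rw [hc, mul_pow, mul_pow, Real.sq_sqrt (by norm_num)]; ring
  -- anything close to z is in the half plane
  have hball : ∀ z w : ℂ, c < z.im → ‖w - z‖ ≤ 2 * σ₁ ^ 2 / z.im → 3 / 4 * z.im < w.im := by
    intro z w hz hw
    have hz0 : 0 < z.im := hc0.trans hz
    have h1 := (Complex.abs_im_le_norm (w - z)).trans hw
    rw [abs_le, Complex.sub_im] at h1
    have h2 : 2 * σ₁ ^ 2 / z.im < z.im / 4 := by
      rw [div_lt_iff₀ hz0]
      nlinarith
    linarith [h1.1]
  have hwb : ∀ n z, c < z.im → ‖wit μ₁ μ₃ n z - z‖ ≤ 2 * σ₁ ^ 2 / z.im := by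
    intro n z hz
    have hz0 : 0 < z.im := hc0.trans hz
    induction n with
    | zero => simp [wit]; positivity
    | succ n ih => exact T_le μ₁ μ₃ hμ₁mom σ₁ hmean₁ hvar₁ hz0 (hball z _ hz ih)
  have hwi : ∀ n z, c < z.im → 3 / 4 * z.im < (wit μ₁ μ₃ n z).im :=
    fun n z hz => hball z _ hz (hwb n z hz)
  have hwd : ∀ n, DifferentiableOn ℂ (wit μ₁ μ₃ n) {z : ℂ | c < z.im} := by
    intro n z hz
    have hz' : c < z.im := hz
    have hz0 : 0 < z.im := hc0.trans hz
    refine DifferentiableAt.differentiableWithinAt ?_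
    induction n with
    | zero => exact differentiableAt_id
    | succ n ih =>
      have h1 := hwi n z hz
      have hF : DifferentiableAt ℂ (fun z => cauchyF μ₃ (wit μ₁ μ₃ n z)) z :=
        DifferentiableAt.comp (g := cauchyF μ₃) (f := wit μ₁ μ₃ n) z
          (F_diff μ₃ (by linarith)) ih
      have hu := (hF.add ih).sub differentiableAt_id
      have hi := im_u μ₃ hz0 h1
      have hh : DifferentiableAt ℂ (hTrans μ₁) (cauchyF μ₃ (wit μ₁ μ₃ n z) + wit μ₁ μ₃ n z - z) :=
        h_diff μ₁ (by linarith)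
      exact (DifferentiableAt.comp (g := hTrans μ₁)
        (f := fun z => cauchyF μ₃ (wit μ₁ μ₃ n z) + wit μ₁ μ₃ n z - z) z hh hu).add differentiableAt_id
  have hq1 : ∀ y z : ℝ, 0 < y → y ≤ z → 8 * σ₁ ^ 2 / z ^ 2 ≤ 8 * σ₁ ^ 2 / y ^ 2 := by
    intro y z hy hyz
    gcongr
  have hq : ∀ y : ℝ, c < y → 8 * σ₁ ^ 2 / y ^ 2 < 1 := by
    intro y hy
    rw [div_lt_one (by have := hc0.trans hy; positivity), ← hc2]
    gcongr
  have hgeo : ∀ (y : ℝ) (z : ℂ), c < y → y ≤ z.im → ∀ n,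
      dist (wit μ₁ μ₃ n z) (wit μ₁ μ₃ (n + 1) z) ≤
        (2 * σ₁ ^ 2 / y) * (8 * σ₁ ^ 2 / y ^ 2) ^ n := by
    intro y z hy hyz n
    have hy0 := hc0.trans hy
    have hz : c < z.im := hy.trans_le hyz
    have hz0 : 0 < z.im := hc0.trans hz
    induction n with
    | zero =>
      rw [dist_comm, dist_eq_norm]
      refine (hwb 1 z hz).trans ?_
      rw [pow_zero, mul_one]
      gcongr
    | succ n ih =>
      rw [dist_eq_norm] at ih ⊢
      refine (T_lip μ₁ μ₃ hμ₁mom σ₁ hmean₁ hvar₁ hz0 (hwi n z hz) (hwi (n + 1) z hz)).trans ?_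
      calc _ ≤ 8 * σ₁ ^ 2 / y ^ 2 * ((2 * σ₁ ^ 2 / y) * (8 * σ₁ ^ 2 / y ^ 2) ^ n) :=
            mul_le_mul (hq1 _ _ hy0 hyz) ih (norm_nonneg _) (by positivity)
        _ = _ := by ring
  have hlim : ∀ z : ℂ, ∃ l, c < z.im → Tendsto (fun n => wit μ₁ μ₃ n z) atTop (nhds l) := by
    intro z
    by_cases hz : c < z.im
    · obtain ⟨l, hl⟩ := cauchySeq_tendsto_of_complete
        (cauchySeq_of_le_geometric _ _ (hq _ hz) (hgeo z.im z hz le_rfl))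
      exact ⟨l, fun _ => hl⟩
    · exact ⟨0, fun h => absurd h hz⟩
  choose w₃ hw₃ using hlim
  have hopen : IsOpen {z : ℂ | c < z.im} := isOpen_lt continuous_const Complex.continuous_im
  refine ⟨w₃, ?_, ?_⟩
  · refine TendstoLocallyUniformlyOn.differentiableOn (φ := atTop) (F := wit μ₁ μ₃) ?_
      (Eventually.of_forall hwd) hopen
    rw [Metric.tendstoLocallyUniformlyOn_iff]
    intro ε hε z hz
    have hz' : c < z.im := hz
    set y := (c + z.im) / 2 with hy
    have hcy : c < y := by linarith
    have hy0 := hc0.trans hcy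
    have hqy := hq y hcy
    refine ⟨{w | y < w.im}, mem_nhdsWithin_of_mem_nhds
      ((isOpen_lt continuous_const Complex.continuous_im).mem_nhds
        (by simp only [Set.mem_ofPred_eq]; linarith)), ?_⟩
    have ht : Tendsto (fun n : ℕ => (2 * σ₁ ^ 2 / y) * (8 * σ₁ ^ 2 / y ^ 2) ^ n /
        (1 - 8 * σ₁ ^ 2 / y ^ 2)) atTop (nhds 0) := by
      have := ((tendsto_pow_atTop_nhds_zero_of_lt_one (by positivity) hqy).const_mul
        (2 * σ₁ ^ 2 / y)).div_const (1 - 8 * σ₁ ^ 2 / y ^ 2)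
      simpa using this
    filter_upwards [ht.eventually_lt_const hε] with n hn w hw
    have hw' : y < w.im := hw
    rw [dist_comm]
    exact (dist_le_of_le_geometric_of_tendsto _ _ hqy (hgeo y w hcy hw'.le)
      (hw₃ w (hcy.trans hw')) n).trans_lt hn
  · intro z hz
    have hz0 : 0 < z.im := hc0.trans hz
    have ht := hw₃ z hz
    have hb : ‖w₃ z - z‖ ≤ 2 * σ₁ ^ 2 / z.im :=
      le_of_tendsto (ht.sub_const z).norm (Eventually.of_forall fun n => hwb n z hz)
    have hi := hball z _ hz hb
    refine ⟨hi, ?_⟩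
    refine tendsto_nhds_unique (f := fun n => wit μ₁ μ₃ (n + 1) z) (l := atTop) ?_
      (ht.comp (tendsto_add_atTop_nat 1))
    rw [tendsto_iff_norm_sub_tendsto_zero] at ht ⊢
    refine squeeze_zero (fun _ => norm_nonneg _)
      (fun n => T_lip μ₁ μ₃ hμ₁mom σ₁ hmean₁ hvar₁ hz0 (hwi n z hz) hi) ?_
    simpa using ht.const_mul (8 * σ₁ ^ 2 / z.im ^ 2)
end

section
/- Let z ∈ ℂ with Im z > 2√2·σ₁ and let w₃(z) be the unique fixed point of T_z in {Im w > (3/4)·Im z}. Set w₁(z) := F_{μ₃}(w₃(z)) + w₃(z) − z. Then Im w₁(z) > (Im z)/2 and F_{μ₁}(w₁(z)) = F_{μ₃}(w₃(z)). -/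
open MeasureTheory Filter

lemma cauchyF_im_ge (μ : Measure ℝ) [IsProbabilityMeasure μ] (w : ℂ) (hw : 0 < w.im) :
    w.im ≤ (cauchyF μ w).im := by
  have hne : ∀ t : ℝ, w - (t : ℂ) ≠ 0 := by
    intro t h
    have := congrArg Complex.im h
    simp at this
    exact hw.ne' this
  have hcont : Continuous (fun t : ℝ => (w - (t : ℂ))⁻¹) :=
    Continuous.inv₀ (by fun_prop) hne
  have hbd : ∀ t : ℝ, ‖(w - (t : ℂ))⁻¹‖ ≤ w.im⁻¹ := by
    intro t
    rw [norm_inv]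
    apply inv_anti₀ hw
    have h := Complex.abs_im_le_norm (w - (t : ℂ))
    simp at h
    exact (le_abs_self _).trans h
  have hint : Integrable (fun t : ℝ => (w - (t : ℂ))⁻¹) μ :=
    Integrable.of_bound hcont.aestronglyMeasurable _ (Eventually.of_forall hbd)
  have hint2 : Integrable (fun t : ℝ => ‖(w - (t : ℂ))⁻¹‖ ^ 2) μ := by
    refine Integrable.of_bound (hcont.norm.pow 2).aestronglyMeasurable (w.im⁻¹ ^ 2)
      (Eventually.of_forall fun t => ?_)
    rw [Real.norm_of_nonneg (by positivity)]
    exact pow_le_pow_left₀ (norm_nonneg _) (hbd t) 2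
  have him : (cauchyG μ w).im = - (w.im * ∫ t, ‖(w - (t : ℂ))⁻¹‖ ^ 2 ∂μ) := by
    have h1 : (cauchyG μ w).im = ∫ t, ((w - (t : ℂ))⁻¹).im ∂μ := (integral_im hint).symm
    rw [h1, ← integral_const_mul, ← integral_neg]
    congr 1
    ext t
    rw [Complex.inv_im, norm_inv, inv_pow, Complex.sq_norm]
    simp [div_eq_mul_inv]
  have hpos : 0 < ∫ t, ‖(w - (t : ℂ))⁻¹‖ ^ 2 ∂μ := by
    rw [integral_pos_iff_support_of_nonneg (fun t => by positivity) hint2]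
    have : Function.support (fun t : ℝ => ‖(w - (t : ℂ))⁻¹‖ ^ 2) = Set.univ := by
      ext t
      simp [hne t]
    rw [this]
    simp
  have hle : ‖cauchyG μ w‖ ^ 2 ≤ ∫ t, ‖(w - (t : ℂ))⁻¹‖ ^ 2 ∂μ := by
    have h1 : ‖cauchyG μ w‖ ≤ ∫ t, ‖(w - (t : ℂ))⁻¹‖ ∂μ := norm_integral_le_integral_norm _
    set m := ∫ t, ‖(w - (t : ℂ))⁻¹‖ ∂μ with hm
    have h2 : 0 ≤ ∫ t, (‖(w - (t : ℂ))⁻¹‖ ^ 2 - 2 * m * ‖(w - (t : ℂ))⁻¹‖ + m ^ 2) ∂μ :=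
      integral_nonneg fun t => by
        have := sq_nonneg (‖(w - (t : ℂ))⁻¹‖ - m)
        simp only [Pi.zero_apply]
        linarith
    have hi1 : Integrable (fun t : ℝ => 2 * m * ‖(w - (t : ℂ))⁻¹‖) μ := hint.norm.const_mul _
    have hi2 : Integrable (fun t : ℝ => ‖(w - (t : ℂ))⁻¹‖ ^ 2 - 2 * m * ‖(w - (t : ℂ))⁻¹‖) μ :=
      hint2.sub hi1
    rw [integral_add hi2 (integrable_const _), integral_sub hint2 hi1, integral_const_mul, ← hm,
      integral_const, probReal_univ, one_smul] at h2
    have h3 := pow_le_pow_left₀ (norm_nonneg _) h1 2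
    linarith
  have hG : cauchyG μ w ≠ 0 := by
    intro h
    rw [h] at him
    simp only [Complex.zero_im] at him
    have := mul_pos hw hpos
    linarith
  have hn : 0 < ‖cauchyG μ w‖ ^ 2 := by positivity
  rw [cauchyF, Complex.inv_im, him, ← Complex.sq_norm, neg_neg, le_div_iff₀ hn]
  exact mul_le_mul_of_nonneg_left hle hw.le

/-- For `Im z > 2√2·σ₁` and `w₃` the fixed point of `T_z` in
`{Im w > (3/4)·Im z}`, the point `w₁ = F_{μ₃}(w₃) + w₃ - z` satisfies
`Im w₁ > (Im z)/2` and `F_{μ₁}(w₁) = F_{μ₃}(w₃)`. -/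
theorem subordination_identity (μ₁ μ₃ : Measure ℝ)
    [IsProbabilityMeasure μ₁] [IsProbabilityMeasure μ₃]
    (hμ₁mom : Integrable (fun t : ℝ => t ^ 2) μ₁)
    (hμ₃mom : Integrable (fun t : ℝ => t ^ 2) μ₃)
    (σ₁ : ℝ) (hσ₁ : 0 < σ₁)
    (hmean₁ : (∫ t, t ∂μ₁) = 0)
    (hvar₁ : (∫ t, t ^ 2 ∂μ₁) = σ₁ ^ 2)
    (z : ℂ) (hz : 2 * Real.sqrt 2 * σ₁ < z.im)
    (w₃ : ℂ) (hw₃im : 3 / 4 * z.im < w₃.im) (hw₃fix : Tadd μ₁ μ₃ z w₃ = w₃) :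
    z.im / 2 < (cauchyF μ₃ w₃ + w₃ - z).im ∧
      cauchyF μ₁ (cauchyF μ₃ w₃ + w₃ - z) = cauchyF μ₃ w₃ := by
  have hz0 : 0 < z.im := lt_trans (by positivity) hz
  have h := cauchyF_im_ge μ₃ w₃ (by linarith)
  refine ⟨?_, ?_⟩
  · simp only [Complex.add_im, Complex.sub_im]
    linarith
  · unfold Tadd hTrans at hw₃fix
    linear_combination -hw₃fix
end

section
/- Let μ₂ be a probability measure on ℝ. Suppose there exist c > 0 and functions ψ₁, ψ₂, ψ₃ : {Im u > c} → ℂ⁺ such that for i = 1,2,3: F_{μᵢ}(ψᵢ(u)) = u for all u with Im u > c; ψᵢ(F_{μᵢ}(w)) = w for all w with Im w > c; and ψ₁(u) + ψ₂(u) = ψ₃(u) + u for all u with Im u > c (this last identity expresses that μ₁ ⊞ μ₂ = μ₃, i.e. φ_{μ₁} + φ_{μ₂} = φ_{μ₃} for the Voiculescu transforms φ_{μᵢ}(u) = ψᵢ(u) − u). Then for every z with Im z > 2√2·σ₁, F_{μ₂}(z) = F_{μ₃}(w₃(z)), where w₃(z) is the unique fixed point of T_z in {Im w > (3/4)·Im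 z}. -/
open MeasureTheory Filter

section aux
set_option linter.unusedSectionVars false
variable (μ : Measure ℝ) [IsProbabilityMeasure μ]

lemma aux_im_le (z : ℂ) (t : ℝ) : z.im ≤ ‖z - (t:ℂ)‖ := by
  have := Complex.abs_im_le_norm (z - (t:ℂ))
  simp at this
  exact (le_abs_self _).trans this

lemma aux_ne {z : ℂ} (hz : 0 < z.im) (t : ℝ) : z - (t:ℂ) ≠ 0 := by
  have := aux_im_le z t
  intro h
  rw [h] at this
  simp at this
  linarith

lemma aux_bound {z : ℂ} (hz : 0 < z.im) (t : ℝ) : ‖(z - (t:ℂ))⁻¹‖ ≤ z.im⁻¹ := by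
  rw [norm_inv]
  exact inv_anti₀ hz (aux_im_le z t)

lemma aux_memLp {z : ℂ} (hz : 0 < z.im) (p : ENNReal) :
    MemLp (fun t : ℝ => (z - (t:ℂ))⁻¹) p μ := by
  refine MemLp.of_bound ?_ z.im⁻¹ (ae_of_all _ (aux_bound hz))
  have : Measurable (fun t : ℝ => (z - (t:ℂ))⁻¹) := by fun_prop
  exact this.aestronglyMeasurable

lemma aux_int {z : ℂ} (hz : 0 < z.im) : Integrable (fun t : ℝ => (z - (t:ℂ))⁻¹) μ :=
  memLp_one_iff_integrable.1 (aux_memLp μ hz 1)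

lemma aux_sq_int {f : ℝ → ℂ} (hf : MemLp f 2 μ) : Integrable (fun t => ‖f t‖ ^ 2) μ :=
  hf.integrable_norm_pow (by norm_num)

lemma aux_cs {f g : ℝ → ℂ} (hf : MemLp f 2 μ) (hg : MemLp g 2 μ) :
    ‖∫ t, f t * g t ∂μ‖ ^ 2 ≤ (∫ t, ‖f t‖ ^ 2 ∂μ) * ∫ t, ‖g t‖ ^ 2 ∂μ := by
  have h1 : ‖∫ t, f t * g t ∂μ‖ ≤ ∫ t, ‖f t‖ * ‖g t‖ ∂μ := by
    refine (norm_integral_le_integral_norm _).trans_eq ?_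
    simp
  have h2 := integral_mul_norm_le_Lp_mul_Lq (μ := μ) (f := f) (g := g)
    (p := 2) (q := 2) (by constructor <;> norm_num) (by simpa using hf) (by simpa using hg)
  simp only [Real.rpow_two] at h2
  have e : ∀ x : ℝ, 0 ≤ x → (x ^ ((1:ℝ)/2)) ^ 2 = x := fun x hx => by
    rw [← Real.sqrt_eq_rpow, Real.sq_sqrt hx]
  calc _ ≤ ((∫ t, ‖f t‖ ^ 2 ∂μ) ^ ((1:ℝ)/2) * (∫ t, ‖g t‖ ^ 2 ∂μ) ^ ((1:ℝ)/2)) ^ 2 :=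
        pow_le_pow_left₀ (norm_nonneg _) (h1.trans h2) 2
    _ = _ := by
        rw [mul_pow, e _ (integral_nonneg fun _ => by positivity),
          e _ (integral_nonneg fun _ => by positivity)]

/-- Second moment of the resolvent. -/
noncomputable def auxI (z : ℂ) : ℝ := ∫ t, ‖(z - (t:ℂ))⁻¹‖ ^ 2 ∂μ

/-- Variance of the resolvent. -/
noncomputable def auxV (z : ℂ) : ℝ := ∫ t, ‖(z - (t:ℂ))⁻¹ - cauchyG μ z‖ ^ 2 ∂μ

lemma aux_I_pos {z : ℂ} (hz : 0 < z.im) : 0 < auxI μ z := by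
  unfold auxI
  rw [integral_pos_iff_support_of_nonneg (fun _ => by positivity) (aux_sq_int μ (aux_memLp μ hz 2))]
  have : Function.support (fun t : ℝ => ‖(z - (t:ℂ))⁻¹‖ ^ 2) = Set.univ := by
    ext t
    simp [aux_ne hz t]
  rw [this]
  simp

lemma aux_G_im {z : ℂ} (hz : 0 < z.im) : (cauchyG μ z).im = - (z.im * auxI μ z) := by
  unfold cauchyG auxI
  have := integral_im (𝕜 := ℂ) (aux_int μ hz)
  simp only [RCLike.im_to_complex] at this
  rw [← this, ← integral_const_mul, ← integral_neg]
  congr 1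
  ext t
  rw [Complex.inv_im, norm_inv, Complex.normSq_eq_norm_sq]
  simp
  ring

lemma aux_G_ne {z : ℂ} (hz : 0 < z.im) : cauchyG μ z ≠ 0 := by
  intro h
  have := aux_G_im μ hz
  rw [h] at this
  have := mul_pos hz (aux_I_pos μ hz)
  simp at *
  rcases ‹z.im = 0 ∨ auxI μ z = 0› with h | h <;> simp_all

lemma aux_F_im {z : ℂ} (hz : 0 < z.im) :
    (cauchyF μ z).im = z.im * (auxI μ z / ‖cauchyG μ z‖ ^ 2) := by
  unfold cauchyF
  rw [Complex.inv_im, aux_G_im μ hz, Complex.normSq_eq_norm_sq]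
  ring

lemma aux_memLp' {z : ℂ} (hz : 0 < z.im) (p : ENNReal) :
    MemLp (fun t : ℝ => (z - (t:ℂ))⁻¹ - cauchyG μ z) p μ :=
  (aux_memLp μ hz p).sub (memLp_const _)

lemma aux_V {z : ℂ} (hz : 0 < z.im) : auxV μ z = auxI μ z - ‖cauchyG μ z‖ ^ 2 := by
  have e : ∀ a b : ℂ, ‖a - b‖ ^ 2 = ‖a‖ ^ 2 + ‖b‖ ^ 2 - 2 * (a.re * b.re + a.im * b.im) := by
    intro a b
    simp only [← Complex.normSq_eq_norm_sq, Complex.normSq_apply, Complex.sub_re, Complex.sub_im]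
    ring
  have hi := aux_int μ hz
  have hre : Integrable (fun t : ℝ => ((z - (t:ℂ))⁻¹).re) μ := hi.re
  have him : Integrable (fun t : ℝ => ((z - (t:ℂ))⁻¹).im) μ := hi.im
  have h1 : ∫ t : ℝ, ((z - (t:ℂ))⁻¹).re ∂μ = (cauchyG μ z).re := integral_re (𝕜 := ℂ) hi
  have h2 : ∫ t : ℝ, ((z - (t:ℂ))⁻¹).im ∂μ = (cauchyG μ z).im := integral_im (𝕜 := ℂ) hi
  have hs := aux_sq_int μ (aux_memLp μ hz 2)
  unfold auxV auxI
  simp_rw [e]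
  rw [integral_sub (hs.fun_add (integrable_const _))
    (((hre.mul_const _).fun_add (him.mul_const _)).const_mul _),
    integral_add hs (integrable_const _), integral_const_mul,
    integral_add (hre.mul_const _) (him.mul_const _), integral_mul_const, integral_mul_const,
    h1, h2]
  simp only [integral_const, probReal_univ, one_smul,
    ← Complex.normSq_eq_norm_sq (cauchyG μ z), Complex.normSq_apply]
  ring

lemma aux_V_nonneg (z : ℂ) : 0 ≤ auxV μ z := integral_nonneg fun _ => by positivity

lemma aux_h_im {z : ℂ} (hz : 0 < z.im) :
    -(hTrans μ z).im = z.im * (auxV μ z / ‖cauchyG μ z‖ ^ 2) := by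
  have hG : ‖cauchyG μ z‖ ≠ 0 := by simpa using aux_G_ne μ hz
  rw [aux_V μ hz, hTrans, Complex.sub_im, aux_F_im μ hz]
  field_simp
  ring

lemma aux_F_im_ge {z : ℂ} (hz : 0 < z.im) : z.im ≤ (cauchyF μ z).im := by
  have h := aux_h_im μ hz
  have : 0 ≤ z.im * (auxV μ z / ‖cauchyG μ z‖ ^ 2) := by
    have := aux_V_nonneg μ z
    positivity
  rw [hTrans, Complex.sub_im] at h
  linarith

lemma aux_int_mul {a b : ℂ} (ha : 0 < a.im) (hb : 0 < b.im) :
    Integrable (fun t : ℝ => (a - (t:ℂ))⁻¹ * (b - (t:ℂ))⁻¹) μ :=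
  MemLp.integrable_mul (aux_memLp μ ha 2) (aux_memLp μ hb 2)

lemma aux_G_sub {a b : ℂ} (ha : 0 < a.im) (hb : 0 < b.im) :
    cauchyG μ b - cauchyG μ a = (a - b) * ∫ t : ℝ, (a - (t:ℂ))⁻¹ * (b - (t:ℂ))⁻¹ ∂μ := by
  unfold cauchyG
  rw [← integral_sub (aux_int μ hb) (aux_int μ ha), ← integral_const_mul]
  congr 1
  ext t
  have := aux_ne ha t
  have := aux_ne hb t
  field_simp
  ring

lemma aux_F_pick {a b : ℂ} (ha : 0 < a.im) (hb : 0 < b.im) :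
    ‖cauchyF μ a - cauchyF μ b‖ ^ 2 ≤
      ‖a - b‖ ^ 2 * (((cauchyF μ a).im / a.im) * ((cauchyF μ b).im / b.im)) := by
  have hGa := aux_G_ne μ ha
  have hGb := aux_G_ne μ hb
  have e : cauchyF μ a - cauchyF μ b =
      (a - b) * ((∫ t : ℝ, (a - (t:ℂ))⁻¹ * (b - (t:ℂ))⁻¹ ∂μ) / (cauchyG μ a * cauchyG μ b)) := by
    rw [← mul_div_assoc, ← aux_G_sub μ ha hb, cauchyF, cauchyF]
    field_simp
  have hcs := aux_cs μ (aux_memLp μ ha 2) (aux_memLp μ hb 2)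
  have hna : 0 < ‖cauchyG μ a‖ := norm_pos_iff.2 hGa
  have hnb : 0 < ‖cauchyG μ b‖ := norm_pos_iff.2 hGb
  rw [e, norm_mul, mul_pow, aux_F_im μ ha, aux_F_im μ hb, mul_div_cancel_left₀ _ ha.ne',
    mul_div_cancel_left₀ _ hb.ne', norm_div, norm_mul, div_pow, mul_pow, div_mul_div_comm]
  unfold auxI
  gcongr

lemma aux_h_pick {a b : ℂ} (ha : 0 < a.im) (hb : 0 < b.im) :
    ‖hTrans μ a - hTrans μ b‖ ^ 2 ≤
      ‖a - b‖ ^ 2 * ((-(hTrans μ a).im / a.im) * (-(hTrans μ b).im / b.im)) := by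
  have hGa := aux_G_ne μ ha
  have hGb := aux_G_ne μ hb
  have hcov : ∫ t : ℝ, ((a - (t:ℂ))⁻¹ - cauchyG μ a) * ((b - (t:ℂ))⁻¹ - cauchyG μ b) ∂μ =
      (∫ t : ℝ, (a - (t:ℂ))⁻¹ * (b - (t:ℂ))⁻¹ ∂μ) - cauchyG μ a * cauchyG μ b := by
    have e : ∀ t : ℝ, ((a - (t:ℂ))⁻¹ - cauchyG μ a) * ((b - (t:ℂ))⁻¹ - cauchyG μ b) =
      ((a - (t:ℂ))⁻¹ * (b - (t:ℂ))⁻¹ - cauchyG μ a * (b - (t:ℂ))⁻¹) -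
        ((a - (t:ℂ))⁻¹ * cauchyG μ b - cauchyG μ a * cauchyG μ b) := fun t => by ring
    simp_rw [e]
    have i1 : Integrable (fun t : ℝ => (a - (t:ℂ))⁻¹ * (b - (t:ℂ))⁻¹ -
        cauchyG μ a * (b - (t:ℂ))⁻¹) μ := (aux_int_mul μ ha hb).sub ((aux_int μ hb).const_mul _)
    have i2 : Integrable (fun t : ℝ => (a - (t:ℂ))⁻¹ * cauchyG μ b -
        cauchyG μ a * cauchyG μ b) μ := ((aux_int μ ha).mul_const _).sub (integrable_const _)
    rw [integral_sub i1 i2,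
      integral_sub (aux_int_mul μ ha hb) ((aux_int μ hb).const_mul _),
      integral_sub ((aux_int μ ha).mul_const _) (integrable_const _),
      integral_const_mul, integral_mul_const]
    simp only [integral_const, probReal_univ, one_smul]
    rw [show ∫ t : ℝ, (a - (t:ℂ))⁻¹ ∂μ = cauchyG μ a from rfl,
      show ∫ t : ℝ, (b - (t:ℂ))⁻¹ ∂μ = cauchyG μ b from rfl]
    ring
  have e : hTrans μ a - hTrans μ b =
      -((a - b) * ((∫ t : ℝ, ((a - (t:ℂ))⁻¹ - cauchyG μ a) * ((b - (t:ℂ))⁻¹ - cauchyG μ b) ∂μ)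
        / (cauchyG μ a * cauchyG μ b))) := by
    rw [hcov, ← mul_div_assoc, mul_sub, ← aux_G_sub μ ha hb, hTrans, hTrans, cauchyF, cauchyF]
    field_simp
    ring
  have hcs := aux_cs μ (aux_memLp' μ ha 2) (aux_memLp' μ hb 2)
  have hna : 0 < ‖cauchyG μ a‖ := norm_pos_iff.2 hGa
  have hnb : 0 < ‖cauchyG μ b‖ := norm_pos_iff.2 hGb
  rw [e, norm_neg, norm_mul, mul_pow, aux_h_im μ ha, aux_h_im μ hb, mul_div_cancel_left₀ _ ha.ne',
    mul_div_cancel_left₀ _ hb.ne', norm_div, norm_mul, div_pow, mul_pow, div_mul_div_comm]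
  unfold auxV
  gcongr

lemma aux_h_bound (hmom : Integrable (fun t : ℝ => t ^ 2) μ) (σ : ℝ)
    (hmean : (∫ t, t ∂μ) = 0) (hvar : (∫ t, t ^ 2 ∂μ) = σ ^ 2) {z : ℂ} (hz : 0 < z.im) :
    ‖hTrans μ z‖ ≤ σ ^ 2 / z.im := by
  have hG := aux_G_ne μ hz
  have hn : 0 < ‖cauchyG μ z‖ := norm_pos_iff.2 hG
  have hid : MemLp (fun t : ℝ => t) 2 μ :=
    (memLp_two_iff_integrable_sq measurable_id.aestronglyMeasurable).2 hmom
  have hidc : MemLp (fun t : ℝ => (t:ℂ)) 2 μ := hid.ofReal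
  have hti : Integrable (fun t : ℝ => (t:ℂ)) μ := hidc.integrable (by norm_num)
  have hprod : Integrable (fun t : ℝ => (t:ℂ) * (z - (t:ℂ))⁻¹) μ :=
    MemLp.integrable_mul hidc (aux_memLp μ hz 2)
  have h1 : ∫ t : ℝ, (t:ℂ) * ((z - (t:ℂ))⁻¹ - cauchyG μ z) ∂μ = z * cauchyG μ z - 1 := by
    simp_rw [mul_sub]
    rw [integral_sub hprod (hti.mul_const _), integral_mul_const]
    have : ∫ t : ℝ, (t:ℂ) ∂μ = 0 := by
      rw [integral_complex_ofReal, hmean]; rfl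
    rw [this, zero_mul, sub_zero, cauchyG, ← integral_const_mul]
    have h3 : (1:ℂ) = ∫ t : ℝ, (1:ℂ) ∂μ := by simp
    rw [h3, ← integral_sub ((aux_int μ hz).const_mul _) (integrable_const _)]
    congr 1
    ext t
    have := aux_ne hz t
    field_simp
    ring
  have e : hTrans μ z = (z * cauchyG μ z - 1) / cauchyG μ z := by
    rw [hTrans, cauchyF]; field_simp
  have hcs := aux_cs μ hidc (aux_memLp' μ hz 2)
  have h4 : ∫ t : ℝ, ‖(t:ℂ)‖ ^ 2 ∂μ = σ ^ 2 := by
    rw [← hvar]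
    congr 1
    ext t
    simp
  rw [h1, h4] at hcs
  have h5 : ‖hTrans μ z‖ ^ 2 ≤ σ ^ 2 * (-(hTrans μ z).im / z.im) := by
    rw [aux_h_im μ hz, mul_div_cancel_left₀ _ hz.ne', e, norm_div, div_pow, ← mul_div_assoc]
    unfold auxV
    gcongr
  have h6 : -(hTrans μ z).im ≤ ‖hTrans μ z‖ := 
    (neg_le_abs _).trans (Complex.abs_im_le_norm _)
  have h7 : ‖hTrans μ z‖ ^ 2 ≤ σ ^ 2 / z.im * ‖hTrans μ z‖ := by
    refine h5.trans ?_
    rw [mul_comm_div]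
    gcongr
  rcases (norm_nonneg (hTrans μ z)).eq_or_lt with h | h
  · rw [← h]; positivity
  · rw [sq] at h7
    exact le_of_mul_le_mul_right h7 h

lemma aux_h_lip (hmom : Integrable (fun t : ℝ => t ^ 2) μ) (σ : ℝ)
    (hmean : (∫ t, t ∂μ) = 0) (hvar : (∫ t, t ^ 2 ∂μ) = σ ^ 2) {a b : ℂ}
    (ha : 0 < a.im) (hb : 0 < b.im) :
    ‖hTrans μ a - hTrans μ b‖ ≤ ‖a - b‖ * (σ ^ 2 / (a.im * b.im)) := by
  have h0 : ∀ {z : ℂ}, 0 < z.im → -(hTrans μ z).im / z.im ≤ (σ / z.im) ^ 2 := by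
    intro z hz
    have h6 : -(hTrans μ z).im ≤ ‖hTrans μ z‖ := 
      (neg_le_abs _).trans (Complex.abs_im_le_norm _)
    have := h6.trans (aux_h_bound μ hmom σ hmean hvar hz)
    rw [div_le_iff₀ hz]
    refine this.trans_eq ?_
    field_simp
  have h1 : ∀ {z : ℂ}, 0 < z.im → 0 ≤ -(hTrans μ z).im / z.im := by
    intro z hz
    have := aux_V_nonneg μ z
    rw [aux_h_im μ hz]
    positivity
  refine le_of_sq_le_sq ?_ (by positivity)
  refine (aux_h_pick μ ha hb).trans ?_
  calc _ ≤ ‖a - b‖ ^ 2 * ((σ / a.im) ^ 2 * (σ / b.im) ^ 2) := by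
        gcongr
        · exact h1 hb
        · exact h0 ha
        · exact h0 hb
    _ = _ := by field_simp

lemma aux_G_diff {z : ℂ} (hz : 0 < z.im) : DifferentiableAt ℂ (cauchyG μ) z := by
  have hs : {w : ℂ | z.im / 2 < w.im} ∈ nhds z :=
    (isOpen_lt continuous_const Complex.continuous_im).mem_nhds (by simp; linarith)
  have := hasDerivAt_integral_of_dominated_loc_of_deriv_le (μ := μ) (𝕜 := ℂ)
    (F := fun (w : ℂ) (t : ℝ) => (w - (t:ℂ))⁻¹)
    (F' := fun (w : ℂ) (t : ℝ) => -1 / (w - (t:ℂ)) ^ 2) (x₀ := z)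
    (bound := fun _ => ((z.im / 2)⁻¹) ^ 2) hs
    (Eventually.of_forall fun w => by
      have : Measurable (fun t : ℝ => (w - (t:ℂ))⁻¹) := by fun_prop
      exact this.aestronglyMeasurable)
    (aux_int μ hz)
    (by
      have : Measurable (fun t : ℝ => -1 / (z - (t:ℂ)) ^ 2) := by fun_prop
      exact this.aestronglyMeasurable)
    (ae_of_all _ fun t w hw => by
      have hw' : z.im / 2 < w.im := hw
      rw [norm_div, norm_neg, norm_one, norm_pow, one_div, ← inv_pow]
      have h2 := aux_im_le w t
      gcongr
      linarith)
    (integrable_const _)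
    (ae_of_all _ fun t w hw => by
      have hw' : z.im / 2 < w.im := hw
      exact ((hasDerivAt_id w).sub_const (t:ℂ)).fun_inv (aux_ne (by rw [id]; linarith) t))
  exact this.2.differentiableAt

lemma aux_F_diff {z : ℂ} (hz : 0 < z.im) : DifferentiableAt ℂ (cauchyF μ) z :=
  (aux_G_diff μ hz).inv (aux_G_ne μ hz)

lemma aux_h_diff {z : ℂ} (hz : 0 < z.im) : DifferentiableAt ℂ (hTrans μ) z :=
  differentiableAt_id.sub (aux_F_diff μ hz)

lemma aux_scalar {y w f s2 k : ℝ} (hy : 0 < y) (hw : 3 / 4 * y ≤ w) (hf : w ≤ f) (hk : 0 ≤ k)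
    (h : 8 * s2 ≤ k * y ^ 2) : s2 * (1 + f / w) ≤ k * (f + w - y) ^ 2 := by
  have hw0 : 0 < w := by linarith
  have h1 : (w + f) * y / 6 ≤ (f + w - y) ^ 2 := by nlinarith
  have h2 : s2 * (w + f) ≤ k * w * (f + w - y) ^ 2 := by
    calc s2 * (w + f) ≤ (k * y ^ 2 / 8) * (w + f) := by gcongr <;> linarith
      _ = k * (3 / 4 * y) * ((w + f) * y / 6) := by ring
      _ ≤ _ := by
        have : 0 ≤ (w + f) * y / 6 := by
          have : 0 < w + f := by linarith
          positivity
        gcongr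
  have e : s2 * (1 + f / w) = s2 * (w + f) / w := by field_simp
  rw [e, div_le_iff₀ hw0]
  linarith

lemma aux_v_im {z w : ℂ} (hz : 0 < z.im) (hw : 3 / 4 * z.im ≤ w.im) :
    z.im / 2 ≤ (cauchyF μ w + w - z).im := by
  have := aux_F_im_ge μ (z := w) (by linarith)
  simp only [Complex.sub_im, Complex.add_im]
  linarith

variable (ν : Measure ℝ) [IsProbabilityMeasure ν]

lemma aux_T_near (hmom : Integrable (fun t : ℝ => t ^ 2) μ) (σ : ℝ)
    (hmean : (∫ t, t ∂μ) = 0) (hvar : (∫ t, t ^ 2 ∂μ) = σ ^ 2) {a : ℝ} (ha : 0 < a)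
    (h8 : 8 * σ ^ 2 ≤ a ^ 2) {z w : ℂ} (hz : a ≤ z.im) (hw : 3 / 4 * z.im ≤ w.im) :
    ‖Tadd μ ν z w - z‖ ≤ a / 4 := by
  have hv := aux_v_im ν (by linarith) hw
  have hv0 : 0 < (cauchyF ν w + w - z).im := by linarith
  rw [Tadd, add_sub_cancel_right]
  refine (aux_h_bound μ hmom σ hmean hvar hv0).trans ?_
  rw [div_le_iff₀ hv0]
  nlinarith

lemma aux_T_im (hmom : Integrable (fun t : ℝ => t ^ 2) μ) (σ : ℝ)
    (hmean : (∫ t, t ∂μ) = 0) (hvar : (∫ t, t ^ 2 ∂μ) = σ ^ 2) {a : ℝ} (ha : 0 < a)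
    (h8 : 8 * σ ^ 2 ≤ a ^ 2) {z w : ℂ} (hz : a ≤ z.im) (hw : 3 / 4 * z.im ≤ w.im) :
    3 / 4 * z.im ≤ (Tadd μ ν z w).im := by
  have h1 := aux_T_near μ ν hmom σ hmean hvar ha h8 hz hw
  have h2 := (Complex.abs_im_le_norm _).trans h1
  rw [Complex.sub_im, abs_le] at h2
  linarith

lemma aux_T_contr (hmom : Integrable (fun t : ℝ => t ^ 2) μ) (σ : ℝ)
    (hmean : (∫ t, t ∂μ) = 0) (hvar : (∫ t, t ^ 2 ∂μ) = σ ^ 2) {a k : ℝ} (ha : 0 < a) (hk : 0 ≤ k)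
    (h8 : 8 * σ ^ 2 ≤ k * a ^ 2) {z w w' : ℂ} (hz : a ≤ z.im) (hw : 3 / 4 * z.im ≤ w.im)
    (hw' : 3 / 4 * z.im ≤ w'.im) :
    ‖Tadd μ ν z w - Tadd μ ν z w'‖ ≤ k * ‖w - w'‖ := by
  have hz0 : 0 < z.im := by linarith
  have hw0 : 0 < w.im := by linarith
  have hw0' : 0 < w'.im := by linarith
  have hv := aux_v_im ν (by linarith) hw
  have hv' := aux_v_im ν (by linarith) hw'
  have h8' : 8 * σ ^ 2 ≤ k * z.im ^ 2 := h8.trans (by gcongr)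
  have s := aux_scalar hz0 hw (aux_F_im_ge ν hw0) hk h8'
  have s' := aux_scalar hz0 hw' (aux_F_im_ge ν hw0') hk h8'
  have hp := aux_F_pick ν hw0 hw0'
  have hlip := aux_h_lip μ hmom σ hmean hvar (a := cauchyF ν w + w - z)
    (b := cauchyF ν w' + w' - z) (by linarith) (by linarith)
  have hf := aux_F_im_ge ν hw0
  have hf' := aux_F_im_ge ν hw0'
  have ev : (cauchyF ν w + w - z).im = (cauchyF ν w).im + w.im - z.im := by simp
  have ev' : (cauchyF ν w' + w' - z).im = (cauchyF ν w').im + w'.im - z.im := by simp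
  rw [← ev] at s
  rw [← ev'] at s'
  set v := (cauchyF ν w + w - z).im
  set v' := (cauchyF ν w' + w' - z).im
  set P := (cauchyF ν w).im / w.im with hP
  set P' := (cauchyF ν w').im / w'.im with hP'
  have hP0 : 0 ≤ P := div_nonneg (by linarith) hw0.le
  have hP0' : 0 ≤ P' := div_nonneg (by linarith) hw0'.le
  have hv0 : 0 < v := by linarith
  have hv0' : 0 < v' := by linarith
  have hF : ‖cauchyF ν w - cauchyF ν w'‖ ≤ ‖w - w'‖ * (√P * √P') := by
    refine le_of_sq_le_sq ?_ (by positivity)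
    refine hp.trans_eq ?_
    rw [mul_pow, mul_pow, Real.sq_sqrt hP0, Real.sq_sqrt hP0']
  have hvv : ‖(cauchyF ν w + w - z) - (cauchyF ν w' + w' - z)‖ ≤ ‖w - w'‖ * (1 + √P * √P') := by
    rw [show (cauchyF ν w + w - z) - (cauchyF ν w' + w' - z) =
      (w - w') + (cauchyF ν w - cauchyF ν w') by ring]
    refine (norm_add_le _ _).trans ?_
    linarith
  have hq : σ ^ 2 * (1 + √P * √P') ≤ k * (v * v') := by
    refine le_of_sq_le_sq ?_ (by positivity)
    calc (σ ^ 2 * (1 + √P * √P')) ^ 2 ≤ (σ ^ 2 * (1 + P)) * (σ ^ 2 * (1 + P')) := by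
          have : (1 + √P * √P') ^ 2 ≤ (1 + P) * (1 + P') := by
            nlinarith [Real.sq_sqrt hP0, Real.sq_sqrt hP0', sq_nonneg (√P - √P')]
          calc _ = (σ ^ 2) ^ 2 * (1 + √P * √P') ^ 2 := by ring
            _ ≤ (σ ^ 2) ^ 2 * ((1 + P) * (1 + P')) := by gcongr
            _ = _ := by ring
      _ ≤ (k * v ^ 2) * (k * v' ^ 2) := by gcongr
      _ = _ := by ring
  rw [Tadd, Tadd, add_sub_add_right_eq_sub]
  refine hlip.trans ?_
  calc _ ≤ ‖w - w'‖ * (1 + √P * √P') * (σ ^ 2 / (v * v')) := by gcongr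
    _ = ‖w - w'‖ * ((σ ^ 2 * (1 + √P * √P')) / (v * v')) := by ring
    _ ≤ ‖w - w'‖ * k := by
      gcongr
      rw [div_le_iff₀ (by positivity)]
      exact hq
    _ = _ := mul_comm _ _

lemma aux_T_exists (hmom : Integrable (fun t : ℝ => t ^ 2) μ) (σ : ℝ)
    (hmean : (∫ t, t ∂μ) = 0) (hvar : (∫ t, t ^ 2 ∂μ) = σ ^ 2) {a k : ℝ} (ha : 0 < a) (hk : 0 ≤ k)
    (hk1 : k < 1) (h8 : 8 * σ ^ 2 ≤ k * a ^ 2) {z : ℂ} (hz : a ≤ z.im) :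
    ∃ p : ℂ, 3 / 4 * z.im ≤ p.im ∧ Tadd μ ν z p = p := by
  have h8' : 8 * σ ^ 2 ≤ a ^ 2 := h8.trans (by nlinarith [sq_nonneg a])
  have hcl : IsClosed {w : ℂ | 3 / 4 * z.im ≤ w.im} :=
    isClosed_le continuous_const Complex.continuous_im
  have hm : Set.MapsTo (Tadd μ ν z) {w : ℂ | 3 / 4 * z.im ≤ w.im} {w : ℂ | 3 / 4 * z.im ≤ w.im} :=
    fun w hw => aux_T_im μ ν hmom σ hmean hvar ha h8' hz hw
  have hcon : ContractingWith ⟨k, hk⟩ (hm.restrict _ _ _) := by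
    refine ⟨by exact_mod_cast hk1, LipschitzWith.of_dist_le_mul fun x y => ?_⟩
    have := aux_T_contr μ ν hmom σ hmean hvar ha hk h8 hz x.2 y.2
    rw [Subtype.dist_eq, Subtype.dist_eq, dist_eq_norm, dist_eq_norm]
    exact this
  obtain ⟨p, hp, hfp, -⟩ := hcon.exists_fixedPoint' hcl.isComplete hm (x := z)
    (by simp only [Set.mem_ofPred_eq]; linarith) (edist_ne_top _ _)
  exact ⟨p, hp, hfp⟩

lemma aux_iter_im (hmom : Integrable (fun t : ℝ => t ^ 2) μ) (σ : ℝ)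
    (hmean : (∫ t, t ∂μ) = 0) (hvar : (∫ t, t ^ 2 ∂μ) = σ ^ 2) {a : ℝ} (ha : 0 < a)
    (h8 : 8 * σ ^ 2 ≤ a ^ 2) {z : ℂ} (hz : a ≤ z.im) (n : ℕ) :
    3 / 4 * z.im ≤ ((Tadd μ ν z)^[n] z).im := by
  induction n with
  | zero => simp; linarith
  | succ n ih =>
    rw [Function.iterate_succ_apply']
    exact aux_T_im μ ν hmom σ hmean hvar ha h8 hz ih

lemma aux_iter_diff (hmom : Integrable (fun t : ℝ => t ^ 2) μ) (σ : ℝ)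
    (hmean : (∫ t, t ∂μ) = 0) (hvar : (∫ t, t ^ 2 ∂μ) = σ ^ 2) {a : ℝ} (ha : 0 < a)
    (h8 : 8 * σ ^ 2 ≤ a ^ 2) {z : ℂ} (hz : a ≤ z.im) (n : ℕ) :
    DifferentiableAt ℂ (fun z => (Tadd μ ν z)^[n] z) z := by
  induction n with
  | zero => simp
  | succ n ih =>
    simp only [Function.iterate_succ_apply']
    have him := aux_iter_im μ ν hmom σ hmean hvar ha h8 hz n
    have hv := aux_v_im ν (by linarith) him
    have h1 : DifferentiableAt ℂ (fun z => cauchyF ν ((Tadd μ ν z)^[n] z)) z :=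
      DifferentiableAt.comp z (g := cauchyF ν) (aux_F_diff ν (by linarith)) ih
    have h2 : DifferentiableAt ℂ
        (fun z => cauchyF ν ((Tadd μ ν z)^[n] z) + (Tadd μ ν z)^[n] z - z) z :=
      (h1.fun_add ih).fun_sub differentiableAt_fun_id
    have h3 : DifferentiableAt ℂ
        (fun z => hTrans μ (cauchyF ν ((Tadd μ ν z)^[n] z) + (Tadd μ ν z)^[n] z - z)) z :=
      DifferentiableAt.comp z (g := hTrans μ) (aux_h_diff μ (by linarith)) h2
    exact h3.fun_add differentiableAt_fun_id

lemma aux_iter_dist (hmom : Integrable (fun t : ℝ => t ^ 2) μ) (σ : ℝ)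
    (hmean : (∫ t, t ∂μ) = 0) (hvar : (∫ t, t ^ 2 ∂μ) = σ ^ 2) {a k : ℝ} (ha : 0 < a) (hk : 0 ≤ k)
    (hk1 : k < 1) (h8 : 8 * σ ^ 2 ≤ k * a ^ 2) {z p : ℂ} (hz : a ≤ z.im)
    (hp : 3 / 4 * z.im ≤ p.im) (hfix : Tadd μ ν z p = p) (n : ℕ) :
    ‖p - (Tadd μ ν z)^[n] z‖ ≤ a / 4 * k ^ n := by
  have h8' : 8 * σ ^ 2 ≤ a ^ 2 := h8.trans (by nlinarith [sq_nonneg a])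
  induction n with
  | zero =>
    have := aux_T_near μ ν hmom σ hmean hvar ha h8' hz hp
    rw [hfix] at this
    simpa using this
  | succ n ih =>
    rw [Function.iterate_succ_apply']
    have him := aux_iter_im μ ν hmom σ hmean hvar ha h8' hz n
    have := aux_T_contr μ ν hmom σ hmean hvar ha hk h8 hz hp him
    rw [hfix] at this
    refine this.trans ?_
    calc _ ≤ k * (a / 4 * k ^ n) := by gcongr
      _ = _ := by ring

end aux


/-- If `μ₁ ⊞ μ₂ = μ₃`, expressed via right inverses `ψᵢ` of the
`F`-transforms on a half-plane `{Im u > c}` satisfying `ψ₁ + ψ₂ = ψ₃ + id`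
(the additivity of Voiculescu transforms), then for every `z` with
`Im z > 2√2·σ₁` one has `F_{μ₂}(z) = F_{μ₃}(w₃(z))` where `w₃(z)` is the unique
fixed point of `T_z` in `{Im w > (3/4)·Im z}`. -/
theorem additive_deconvolution_subordination (μ₁ μ₂ μ₃ : Measure ℝ)
    [IsProbabilityMeasure μ₁] [IsProbabilityMeasure μ₂] [IsProbabilityMeasure μ₃]
    (hμ₁mom : Integrable (fun t : ℝ => t ^ 2) μ₁)
    (hμ₃mom : Integrable (fun t : ℝ => t ^ 2) μ₃)
    (σ₁ : ℝ) (hσ₁ : 0 < σ₁)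
    (hmean₁ : (∫ t, t ∂μ₁) = 0)
    (hvar₁ : (∫ t, t ^ 2 ∂μ₁) = σ₁ ^ 2)
    (c : ℝ) (hc : 0 < c) (ψ₁ ψ₂ ψ₃ : ℂ → ℂ)
    (hψ₁pos : ∀ u : ℂ, c < u.im → 0 < (ψ₁ u).im)
    (hψ₂pos : ∀ u : ℂ, c < u.im → 0 < (ψ₂ u).im)
    (hψ₃pos : ∀ u : ℂ, c < u.im → 0 < (ψ₃ u).im)
    (hψ₁right : ∀ u : ℂ, c < u.im → cauchyF μ₁ (ψ₁ u) = u)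
    (hψ₂right : ∀ u : ℂ, c < u.im → cauchyF μ₂ (ψ₂ u) = u)
    (hψ₃right : ∀ u : ℂ, c < u.im → cauchyF μ₃ (ψ₃ u) = u)
    (hψ₁left : ∀ w : ℂ, c < w.im → ψ₁ (cauchyF μ₁ w) = w)
    (hψ₂left : ∀ w : ℂ, c < w.im → ψ₂ (cauchyF μ₂ w) = w)
    (hψ₃left : ∀ w : ℂ, c < w.im → ψ₃ (cauchyF μ₃ w) = w)
    (hconv : ∀ u : ℂ, c < u.im → ψ₁ u + ψ₂ u = ψ₃ u + u)
    (z : ℂ) (hz : 2 * Real.sqrt 2 * σ₁ < z.im)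
    (w₃ : ℂ) (hw₃im : 3 / 4 * z.im < w₃.im) (hw₃fix : Tadd μ₁ μ₃ z w₃ = w₃) :
    cauchyF μ₂ z = cauchyF μ₃ w₃ := by
  set a : ℝ := (2 * √2 * σ₁ + z.im) / 2 with ha_def
  have hs0 : 0 < 2 * √2 * σ₁ := by positivity
  have haz : a < z.im := by rw [ha_def]; linarith
  have ha1 : 2 * √2 * σ₁ < a := by rw [ha_def]; linarith
  have ha : 0 < a := by linarith
  have h8lt : 8 * σ₁ ^ 2 < a ^ 2 := by
    have h2 : √2 ^ 2 = (2:ℝ) := Real.sq_sqrt (by norm_num)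
    have : (2 * √2 * σ₁) ^ 2 = 8 * σ₁ ^ 2 := by
      rw [mul_pow, mul_pow, h2]; ring
    rw [← this]
    gcongr
  set k : ℝ := 8 * σ₁ ^ 2 / a ^ 2 with hk_def
  have hk : 0 ≤ k := by positivity
  have hk1 : k < 1 := by rw [hk_def, div_lt_one (by positivity)]; exact h8lt
  have h8 : 8 * σ₁ ^ 2 ≤ k * a ^ 2 := by
    rw [hk_def, div_mul_cancel₀ _ (by positivity)]
  have hex : ∀ ζ : ℂ, a ≤ ζ.im → ∃ p : ℂ, 3 / 4 * ζ.im ≤ p.im ∧ Tadd μ₁ μ₃ ζ p = p :=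
    fun ζ hζ => aux_T_exists μ₁ μ₃ hμ₁mom σ₁ hmean₁ hvar₁ ha hk hk1 h8 hζ
  choose! W hWim hWfix using hex
  have hopen : IsOpen {ζ : ℂ | a < ζ.im} := isOpen_lt continuous_const Complex.continuous_im
  have hunif : TendstoUniformlyOn (fun (n : ℕ) (ζ : ℂ) => (Tadd μ₁ μ₃ ζ)^[n] ζ) W atTop
      {ζ : ℂ | a < ζ.im} := by
    rw [Metric.tendstoUniformlyOn_iff]
    intro ε hε
    have hlim : Tendsto (fun n : ℕ => a / 4 * k ^ n) atTop (nhds 0) := by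
      simpa using (tendsto_pow_atTop_nhds_zero_of_lt_one hk hk1).const_mul (a / 4)
    filter_upwards [hlim.eventually_lt_const hε] with n hn ζ hζ
    have hζ' : a ≤ ζ.im := le_of_lt hζ
    rw [dist_eq_norm]
    exact (aux_iter_dist μ₁ μ₃ hμ₁mom σ₁ hmean₁ hvar₁ ha hk hk1 h8 hζ' (hWim ζ hζ')
      (hWfix ζ hζ') n).trans_lt hn
  have hWdiff : DifferentiableOn ℂ W {ζ : ℂ | a < ζ.im} :=
    hunif.tendstoLocallyUniformlyOn.differentiableOn
      (Eventually.of_forall fun n ζ hζ =>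
        (aux_iter_diff μ₁ μ₃ hμ₁mom σ₁ hmean₁ hvar₁ ha h8lt.le (le_of_lt hζ) n).differentiableWithinAt)
      hopen
  have hf : DifferentiableOn ℂ (cauchyF μ₂) {ζ : ℂ | a < ζ.im} := fun ζ hζ =>
    (aux_F_diff μ₂ (ha.trans hζ)).differentiableWithinAt
  have hg : DifferentiableOn ℂ (fun ζ => cauchyF μ₃ (W ζ)) {ζ : ℂ | a < ζ.im} := fun ζ hζ => by
    have hζ' : a < ζ.im := hζ
    have := hWim ζ hζ'.le
    exact DifferentiableAt.comp_differentiableWithinAt ζ (g := cauchyF μ₃)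
      (aux_F_diff μ₃ (by linarith)) (hWdiff ζ hζ)
  have hconvex : IsPreconnected {ζ : ℂ | a < ζ.im} :=
    (convex_halfSpace_im_gt a).isPreconnected
  have hlarge : ∀ ζ : ℂ, a < ζ.im → 2 * c < ζ.im → cauchyF μ₂ ζ = cauchyF μ₃ (W ζ) := by
    intro ζ hζ hζc
    have him := hWim ζ hζ.le
    have hfix := hWfix ζ hζ.le
    have hF := aux_F_im_ge μ₃ (z := W ζ) (by linarith)
    have hv := aux_v_im μ₃ (z := ζ) (w := W ζ) (by linarith) him
    have hF1 : cauchyF μ₁ (cauchyF μ₃ (W ζ) + W ζ - ζ) = cauchyF μ₃ (W ζ) := by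
      rw [Tadd, hTrans] at hfix
      linear_combination -hfix
    have hu : c < (cauchyF μ₃ (W ζ)).im := by linarith
    have e3 := hψ₃left (W ζ) (by linarith)
    have e1 := hψ₁left (cauchyF μ₃ (W ζ) + W ζ - ζ) (by linarith)
    rw [hF1] at e1
    have e := hconv _ hu
    rw [e1, e3] at e
    have e2 : ψ₂ (cauchyF μ₃ (W ζ)) = ζ := by linear_combination e
    have := hψ₂right _ hu
    rwa [e2] at this
  have hev : cauchyF μ₂ =ᶠ[nhds (((a + 2 * c : ℝ) : ℂ) * Complex.I)] fun ζ => cauchyF μ₃ (W ζ) := by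
    have ho : IsOpen {ζ : ℂ | max a (2 * c) < ζ.im} :=
      isOpen_lt continuous_const Complex.continuous_im
    filter_upwards [ho.mem_nhds (x := ((a + 2 * c : ℝ) : ℂ) * Complex.I)
      (by simp; exact ⟨hc, ha⟩)] with ζ hζ
    have hζ' : max a (2 * c) < ζ.im := hζ
    exact hlarge ζ ((le_max_left _ _).trans_lt hζ') ((le_max_right _ _).trans_lt hζ')
  have hEq := (hf.analyticOnNhd hopen).eqOn_of_preconnected_of_eventuallyEq
    (hg.analyticOnNhd hopen) hconvex (z₀ := ((a + 2 * c : ℝ) : ℂ) * Complex.I)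
    (by simp; exact hc) hev
  have hzz := hEq (x := z) haz
  simp only at hzz
  rw [hzz]
  congr 1
  have hcon := aux_T_contr μ₁ μ₃ hμ₁mom σ₁ hmean₁ hvar₁ ha hk h8 haz.le (hWim z haz.le) hw₃im.le
  rw [hWfix z haz.le, hw₃fix] at hcon
  have h0 : ‖W z - w₃‖ = 0 := by
    have := norm_nonneg (W z - w₃)
    nlinarith
  exact sub_eq_zero.1 (norm_eq_zero.1 h0)
end

section
/- Define F̃(z) := F_{μ₃}(w₃(z + 2√2·σ₁·i)) for z ∈ ℂ⁺, where w₃(ζ) is the unique fixed point of T_ζ in {Im w > (3/4)·Im ζ} for Im ζ > 2√2·σ₁. Then F̃ is holomorphic on ℂ⁺ with values in ℂ⁺, F̃(iy)/(iy) → 1 as y → ∞, and there exists a probability measure μ̃ on ℝ such that G_{μ̃}(z) = 1/F̃(z) for all z ∈ ℂ⁺ (i.e. F̃ = F_{μ̃}). -/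
open MeasureTheory Filter

lemma ct_cs {α : Type*} [MeasurableSpace α] (μ : Measure α) (u v : α → ℂ)
    (hu : MemLp u 2 μ) (hv : MemLp v 2 μ) :
    ‖∫ t, u t * v t ∂μ‖ ^ 2 ≤ (∫ t, ‖u t‖ ^ 2 ∂μ) * ∫ t, ‖v t‖ ^ 2 ∂μ := by
  have h1 : ‖∫ t, u t * v t ∂μ‖ ≤ ∫ t, ‖u t‖ * ‖v t‖ ∂μ := by
    refine (norm_integral_le_integral_norm _).trans (le_of_eq ?_)
    simp
  have h2 := integral_mul_norm_le_Lp_mul_Lq (μ := μ) (f := u) (g := v) (p := 2) (q := 2)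
    Real.HolderConjugate.two_two (by simpa using hu) (by simpa using hv)
  have h3 := h1.trans h2
  have e1 : 0 ≤ ∫ t, ‖u t‖ ^ 2 ∂μ := integral_nonneg fun _ => by positivity
  have e2 : 0 ≤ ∫ t, ‖v t‖ ^ 2 ∂μ := integral_nonneg fun _ => by positivity
  simp only [Real.rpow_two, ← Real.sqrt_eq_rpow] at h3
  calc _ ≤ (√(∫ t, ‖u t‖ ^ 2 ∂μ) * √(∫ t, ‖v t‖ ^ 2 ∂μ)) ^ 2 := by gcongr
    _ = _ := by rw [mul_pow, Real.sq_sqrt e1, Real.sq_sqrt e2]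

lemma ct_ne {a : ℂ} (ha : 0 < a.im) (t : ℝ) : a - (t : ℂ) ≠ 0 := by
  intro h
  have := congrArg Complex.im h
  simp at this
  linarith

lemma ct_bound {a : ℂ} (ha : 0 < a.im) (t : ℝ) : ‖(a - (t : ℂ))⁻¹‖ ≤ a.im⁻¹ := by
  rw [norm_inv]
  gcongr
  have := Complex.abs_im_le_norm (a - (t : ℂ))
  simp at this
  exact (le_abs_self _).trans this

lemma ct_cont {a : ℂ} (ha : 0 < a.im) : Continuous fun t : ℝ => (a - (t : ℂ))⁻¹ :=
  Continuous.inv₀ (by fun_prop) (ct_ne ha)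

section basics
variable (μ : Measure ℝ) [IsProbabilityMeasure μ]

lemma ct_int {a : ℂ} (ha : 0 < a.im) : Integrable (fun t : ℝ => (a - (t : ℂ))⁻¹) μ :=
  Integrable.of_bound (ct_cont ha).aestronglyMeasurable a.im⁻¹ (ae_of_all _ (ct_bound ha))

lemma ct_sq_int {a : ℂ} (ha : 0 < a.im) : Integrable (fun t : ℝ => ‖(a - (t : ℂ))⁻¹‖ ^ 2) μ := by
  refine Integrable.of_bound ((ct_cont ha).norm.pow 2).aestronglyMeasurable (a.im⁻¹ ^ 2)
    (ae_of_all _ fun t => ?_)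
  have := ct_bound ha t
  rw [Real.norm_of_nonneg (by positivity)]
  gcongr

lemma ct_G_im {a : ℂ} (ha : 0 < a.im) :
    (cauchyG μ a).im = - (a.im * ∫ t : ℝ, ‖(a - (t : ℂ))⁻¹‖ ^ 2 ∂μ) := by
  have : (cauchyG μ a).im = ∫ t : ℝ, ((a - (t : ℂ))⁻¹).im ∂μ :=
    (integral_im (ct_int μ ha)).symm
  rw [this, ← integral_const_mul, ← integral_neg]
  congr 1
  ext t
  simp [Complex.inv_im, Complex.normSq_eq_norm_sq]
  field_simp

lemma ct_sq_pos {a : ℂ} (ha : 0 < a.im) : 0 < ∫ t : ℝ, ‖(a - (t : ℂ))⁻¹‖ ^ 2 ∂μ := by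
  rw [integral_pos_iff_support_of_nonneg (fun _ => by positivity) (ct_sq_int μ ha)]
  have : (Function.support fun t : ℝ => ‖(a - (t : ℂ))⁻¹‖ ^ 2) = Set.univ := by
    ext t; simp [ct_ne ha t]
  rw [this]; simp

lemma ct_G_ne {a : ℂ} (ha : 0 < a.im) : cauchyG μ a ≠ 0 := by
  intro h
  have := ct_G_im μ ha
  have h2 := mul_pos ha (ct_sq_pos μ ha)
  rw [h] at this
  simp at this
  rcases this with h | h
  · linarith
  · have := ct_sq_pos μ ha
    simp at this
    linarith

/-- the auxiliary mean-zero function -/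
noncomputable def ctv (a : ℂ) (t : ℝ) : ℂ := (a - (t : ℂ))⁻¹ * cauchyF μ a - 1

lemma ctv_cont {a : ℂ} (ha : 0 < a.im) : Continuous (ctv μ a) := by
  have := ct_cont ha
  unfold ctv
  fun_prop

lemma ctv_memLp {a : ℂ} (ha : 0 < a.im) (p : ENNReal) : MemLp (ctv μ a) p μ := by
  refine MemLp.of_bound (ctv_cont μ ha).aestronglyMeasurable (a.im⁻¹ * ‖cauchyF μ a‖ + 1)
    (ae_of_all _ fun t => ?_)
  unfold ctv
  refine (norm_sub_le _ _).trans ?_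
  rw [norm_mul, norm_one]
  have := ct_bound ha t
  gcongr

lemma ctv_int {a : ℂ} (ha : 0 < a.im) : Integrable (ctv μ a) μ :=
  (memLp_one_iff_integrable).1 (ctv_memLp μ ha 1)

lemma ctv_mean {a : ℂ} (ha : 0 < a.im) : ∫ t, ctv μ a t ∂μ = 0 := by
  unfold ctv
  rw [integral_sub ((ct_int μ ha).mul_const _) (integrable_const _), integral_mul_const]
  change cauchyG μ a * cauchyF μ a - _ = 0
  simp [cauchyF, ct_G_ne μ ha]

lemma ctv_mul {a b : ℂ} (ha : 0 < a.im) (hb : 0 < b.im) :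
    (a - b) * ∫ t, ctv μ a t * ctv μ b t ∂μ =
      (cauchyF μ a - a) - (cauchyF μ b - b) := by
  have e : ∀ t, (a - b) * (ctv μ a t * ctv μ b t) =
      cauchyF μ a * cauchyF μ b * ((b - (t : ℂ))⁻¹ - (a - (t : ℂ))⁻¹) -
      (a - b) * ctv μ a t - (a - b) * ctv μ b t - (a - b) := by
    intro t
    have h1 := ct_ne ha t
    have h2 := ct_ne hb t
    unfold ctv
    field_simp
    ring
  rw [← integral_const_mul]
  simp_rw [e]
  have i1 := ct_int μ ha
  have i2 := ct_int μ hb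
  have i3 := ctv_int μ ha
  have i4 := ctv_int μ hb
  rw [integral_sub (by fun_prop) (by fun_prop), integral_sub (by fun_prop) (by fun_prop),
    integral_sub (by fun_prop) (by fun_prop), integral_const_mul, integral_const_mul,
    integral_const_mul, ctv_mean μ ha, ctv_mean μ hb, integral_sub i2 i1]
  change cauchyF μ a * cauchyF μ b * (cauchyG μ b - cauchyG μ a) - _ - _ - _ = _
  have g1 := ct_G_ne μ ha
  have g2 := ct_G_ne μ hb
  simp [cauchyF]
  field_simp
  ring

lemma ctv_sq {a : ℂ} (ha : 0 < a.im) :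
    a.im * ∫ t, ‖ctv μ a t‖ ^ 2 ∂μ = (cauchyF μ a).im - a.im := by
  have e : ∀ t, ‖ctv μ a t‖ ^ 2 = ‖cauchyF μ a‖ ^ 2 * ‖(a - (t : ℂ))⁻¹‖ ^ 2
      - 2 * (ctv μ a t).re - 1 := by
    intro t
    unfold ctv
    rw [← mul_pow, ← norm_mul, mul_comm]
    simp only [← Complex.normSq_eq_norm_sq, Complex.normSq_apply, Complex.sub_re, Complex.sub_im,
      Complex.one_re, Complex.one_im]
    ring
  simp_rw [e]
  have i1 := ct_sq_int μ ha
  have i3 := ctv_int μ ha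
  have i4 : Integrable (fun t => (ctv μ a t).re) μ := i3.re
  have i5 : ∫ t, (ctv μ a t).re ∂μ = 0 := by
    have := integral_re i3
    simp only [RCLike.re_eq_complex_re] at this
    rw [this, ctv_mean μ ha]; simp
  rw [integral_sub (by fun_prop) (by fun_prop), integral_sub (by fun_prop) (by fun_prop),
    integral_const_mul, integral_const_mul, i5]
  have g1 := ct_G_ne μ ha
  have g2 := ct_G_im μ ha
  have : (cauchyF μ a).im = ‖cauchyF μ a‖ ^ 2 * (a.im * ∫ t : ℝ, ‖(a - (t : ℂ))⁻¹‖ ^ 2 ∂μ) := by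
    rw [← neg_eq_iff_eq_neg.2 g2]
    simp [cauchyF, Complex.inv_im, Complex.normSq_eq_norm_sq]
    field_simp
  rw [this]
  simp
  ring

lemma ct_F_im {a : ℂ} (ha : 0 < a.im) : a.im ≤ (cauchyF μ a).im := by
  have := ctv_sq μ ha
  have h : 0 ≤ ∫ t, ‖ctv μ a t‖ ^ 2 ∂μ := integral_nonneg fun _ => by positivity
  nlinarith

/-- Pick inequality for `F - id`. -/
lemma ct_pick {a b : ℂ} (ha : 0 < a.im) (hb : 0 < b.im) :
    ∃ k : ℂ, (cauchyF μ a - a) - (cauchyF μ b - b) = (a - b) * k ∧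
      ‖k‖ ^ 2 * (a.im * b.im) ≤ ((cauchyF μ a).im - a.im) * ((cauchyF μ b).im - b.im) := by
  refine ⟨_, (ctv_mul μ ha hb).symm, ?_⟩
  have := ct_cs μ _ _ (ctv_memLp μ ha 2) (ctv_memLp μ hb 2)
  rw [← ctv_sq μ ha, ← ctv_sq μ hb]
  nlinarith [mul_pos ha hb]

lemma ct_h_bound (hm : Integrable (fun t : ℝ => t ^ 2) μ) {a : ℂ} (ha : 0 < a.im) :
    ‖hTrans μ a - ((∫ t, t ∂μ : ℝ) : ℂ)‖ * a.im ≤ ∫ t, (t - ∫ s, s ∂μ) ^ 2 ∂μ := by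
  set m := ∫ t, t ∂μ with hmdef
  have L2 : MemLp (fun t : ℝ => t) 2 μ :=
    (memLp_two_iff_integrable_sq (by fun_prop)).2 hm
  have L2' : MemLp (fun t : ℝ => ((t - m : ℝ) : ℂ)) 2 μ :=
    (L2.sub (memLp_const m)).ofReal
  have i0 : Integrable (fun t : ℝ => t) μ := L2.integrable (by norm_num)
  have i0' : Integrable (fun t : ℝ => ((t - m : ℝ) : ℂ)) μ := L2'.integrable (by norm_num)
  have hh : ∫ t, ((t - m : ℝ) : ℂ) * ctv μ a t ∂μ = hTrans μ a - m := by
    have e : ∀ t : ℝ, ((t - m : ℝ) : ℂ) * ctv μ a t =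
        (a - m) * ctv μ a t + (a - m) - cauchyF μ a - ((t - m : ℝ) : ℂ) := by
      intro t
      have h1 := ct_ne ha t
      unfold ctv
      push_cast
      field_simp
      ring
    have i3 := ctv_int μ ha
    simp_rw [e]
    rw [integral_sub (by fun_prop) i0', integral_sub (by fun_prop) (by fun_prop),
      integral_add (by fun_prop) (by fun_prop), integral_const_mul, ctv_mean μ ha,
      integral_complex_ofReal, integral_sub i0 (by fun_prop), ← hmdef]
    simp [hTrans]
    ring
  have cs := ct_cs μ _ _ L2' (ctv_memLp μ ha 2)
  rw [hh] at cs
  have e2 : ∫ t : ℝ, ‖((t - m : ℝ) : ℂ)‖ ^ 2 ∂μ = ∫ t, (t - m) ^ 2 ∂μ := by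
    simp_rw [Complex.norm_real, Real.norm_eq_abs, sq_abs]
  rw [e2] at cs
  have e3 := ctv_sq μ ha
  have e4 : (cauchyF μ a).im - a.im ≤ ‖hTrans μ a - m‖ := by
    have := Complex.abs_im_le_norm (hTrans μ a - m)
    simp [hTrans] at this
    rw [abs_sub_comm] at this
    exact (le_abs_self _).trans this
  have e5 : 0 ≤ ∫ t, (t - m) ^ 2 ∂μ := integral_nonneg fun _ => by positivity
  rcases (norm_nonneg (hTrans μ a - m)).eq_or_lt with h | h
  · rw [← h]; simpa using e5
  · have : ‖hTrans μ a - m‖ * (‖hTrans μ a - m‖ * a.im) ≤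
      ‖hTrans μ a - m‖ * ∫ t, (t - m) ^ 2 ∂μ := by
      calc _ = ‖hTrans μ a - m‖ ^ 2 * a.im := by ring
        _ ≤ ((∫ t, (t - m) ^ 2 ∂μ) * ∫ t, ‖ctv μ a t‖ ^ 2 ∂μ) * a.im := by gcongr
        _ = (∫ t, (t - m) ^ 2 ∂μ) * ((cauchyF μ a).im - a.im) := by rw [← e3]; ring
        _ ≤ (∫ t, (t - m) ^ 2 ∂μ) * ‖hTrans μ a - m‖ := by gcongr
        _ = _ := by ring
    exact le_of_mul_le_mul_left this h

lemma ct_F_diff {a : ℂ} (ha : 0 < a.im) : DifferentiableAt ℂ (cauchyF μ) a := by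
  have e : cauchyG μ = fun z => - resolventTransform μ z := by
    ext z
    rw [resolventTransform_apply, ← integral_neg]
    unfold cauchyG
    congr 1
    ext t
    simp [resolvent]
    rw [← inv_neg, neg_sub]
  have : a ∉ algebraMap ℝ ℂ '' μ.support := by
    rintro ⟨x, -, hx⟩
    exact ct_ne ha x (by rw [← hx]; simp)
  have h2 : DifferentiableAt ℂ (cauchyG μ) a := by
    rw [e]
    exact (hasDerivAt_resolventTransform a this).differentiableAt.neg
  exact h2.inv (ct_G_ne μ ha)

end basics

/-- `N = F - id`. -/
noncomputable def ctN (μ : Measure ℝ) (a : ℂ) : ℂ := cauchyF μ a - a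

section fixedpoint

lemma ctN_diff (μ : Measure ℝ) [IsProbabilityMeasure μ] {a : ℂ} (ha : 0 < a.im) :
    DifferentiableAt ℂ (ctN μ) a := (ct_F_diff μ ha).sub differentiableAt_id

lemma ctN_im_nonneg (μ : Measure ℝ) [IsProbabilityMeasure μ] {a : ℂ} (ha : 0 < a.im) :
    0 ≤ (ctN μ a).im := by
  have := ct_F_im μ ha
  simp [ctN]; linarith

lemma ctN_pick_ne (μ : Measure ℝ) [IsProbabilityMeasure μ] {a b : ℂ} (ha : 0 < a.im)
    (hb : 0 < b.im) (hab : b ≠ a) :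
    ‖dslope (ctN μ) a b‖ ^ 2 * (a.im * b.im) ≤ (ctN μ a).im * (ctN μ b).im := by
  obtain ⟨k, hk, hk2⟩ := ct_pick μ hb ha
  have h := sub_smul_dslope (ctN μ) a b
  have : dslope (ctN μ) a b = k := by
    have h3 : b - a ≠ 0 := sub_ne_zero.2 hab
    apply mul_left_cancel₀ h3
    rw [← hk, ← smul_eq_mul, h, ctN, ctN]
  rw [this]
  simp only [ctN, Complex.sub_im]
  linarith [hk2]

lemma ctN_pick (μ : Measure ℝ) [IsProbabilityMeasure μ] {a b : ℂ} (ha : 0 < a.im)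
    (hb : 0 < b.im) :
    ‖dslope (ctN μ) a b‖ ^ 2 * (a.im * b.im) ≤ (ctN μ a).im * (ctN μ b).im := by
  by_cases hab : b = a
  swap
  · exact ctN_pick_ne μ ha hb hab
  subst hab
  have hd := ctN_diff μ ha
  have c1 : ContinuousAt (dslope (ctN μ) b) b := continuousAt_dslope_same.2 hd
  have c2 := hd.continuousAt
  have t1 : Tendsto (fun x => ‖dslope (ctN μ) b x‖ ^ 2 * (b.im * x.im)) (nhdsWithin b {b}ᶜ)
      (nhds (‖dslope (ctN μ) b b‖ ^ 2 * (b.im * b.im))) := by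
    apply Tendsto.mono_left _ nhdsWithin_le_nhds
    exact (c1.norm.pow 2).mul (continuousAt_const.mul Complex.continuous_im.continuousAt)
  have t2 : Tendsto (fun x => (ctN μ b).im * (ctN μ x).im) (nhdsWithin b {b}ᶜ)
      (nhds ((ctN μ b).im * (ctN μ b).im)) := by
    apply Tendsto.mono_left _ nhdsWithin_le_nhds
    exact continuousAt_const.mul (Complex.continuous_im.continuousAt.comp c2)
  refine le_of_tendsto_of_tendsto t1 t2 ?_
  have op : IsOpen {z : ℂ | 0 < z.im} := isOpen_lt continuous_const Complex.continuous_im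
  filter_upwards [self_mem_nhdsWithin, mem_nhdsWithin_of_mem_nhds (op.mem_nhds ha)] with x h1 h2
  exact ctN_pick_ne μ ha h2 h1

variable (μ₁ μ₃ : Measure ℝ) [IsProbabilityMeasure μ₁] [IsProbabilityMeasure μ₃]

/-- the fixed point data at `ζ` -/
structure FP (σ : ℝ) (ζ w : ℂ) : Prop where
  Ypos : 0 < ζ.im
  Ybig : 8 * σ ^ 2 < ζ.im ^ 2
  im_w : 3 / 4 * ζ.im < w.im
  fix : Tadd μ₁ μ₃ ζ w = w

/-- the companion point -/
noncomputable def ctom (ζ w : ℂ) : ℂ := cauchyF μ₃ w + w - ζ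

variable {μ₁ μ₃} {σ : ℝ} {ζ w ζ' w' : ℂ}

lemma FP.w_pos (h : FP μ₁ μ₃ σ ζ w) : 0 < w.im := by
  have := h.Ypos; have := h.im_w; linarith

lemma FP.om_im (h : FP μ₁ μ₃ σ ζ w) : ζ.im / 2 < (ctom μ₃ ζ w).im := by
  have := ct_F_im μ₃ h.w_pos
  have := h.im_w
  simp [ctom]; linarith

lemma FP.om_pos (h : FP μ₁ μ₃ σ ζ w) : 0 < (ctom μ₃ ζ w).im := by
  have := h.om_im; have := h.Ypos; linarith

lemma FP.eq (h : FP μ₁ μ₃ σ ζ w) : w - ζ = - ctN μ₁ (ctom μ₃ ζ w) := by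
  have := h.fix
  simp only [Tadd, hTrans] at this
  simp only [ctN, ctom]
  linear_combination -this

lemma FP.dist (h : FP μ₁ μ₃ σ ζ w) (hμ₁mom : Integrable (fun t : ℝ => t ^ 2) μ₁)
    (hmean₁ : (∫ t, t ∂μ₁) = 0) (hvar₁ : (∫ t, t ^ 2 ∂μ₁) = σ ^ 2) :
    ‖w - ζ‖ < ζ.im / 4 := by
  have hb := ct_h_bound μ₁ hμ₁mom h.om_pos
  simp only [hmean₁, sub_zero, hvar₁, Complex.ofReal_zero] at hb
  have e : hTrans μ₁ (ctom μ₃ ζ w) = w - ζ := by rw [h.eq]; simp [hTrans, ctN]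
  rw [e] at hb
  have h1 := h.om_im
  have h2 := h.Ybig
  have h3 := h.Ypos
  by_contra hc
  push Not at hc
  nlinarith

/-- `B = p / Im ω` -/
noncomputable def FPB (μ₁ μ₃ : Measure ℝ) (ζ w : ℂ) : ℝ :=
  (ctN μ₁ (ctom μ₃ ζ w)).im / (ctom μ₃ ζ w).im

/-- `A - 1` -/
noncomputable def FPA (μ₃ : Measure ℝ) (w : ℂ) : ℝ := (ctN μ₃ w).im / w.im

lemma FP.kappa (h : FP μ₁ μ₃ σ ζ w) (hd : ‖w - ζ‖ < ζ.im / 4) :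
    0 ≤ FPB μ₁ μ₃ ζ w ∧ 0 ≤ FPA μ₃ w ∧ FPB μ₁ μ₃ ζ w * (2 + FPA μ₃ w) < 1 := by
  have h1 := ctN_im_nonneg μ₁ h.om_pos
  have h2 := ctN_im_nonneg μ₃ h.w_pos
  have ho := h.om_pos
  have hw := h.w_pos
  refine ⟨by unfold FPB; positivity, by unfold FPA; positivity, ?_⟩
  have e1 := congrArg Complex.im h.eq
  have e2 : (ctom μ₃ ζ w).im = (ctN μ₃ w).im + 2 * w.im - ζ.im := by
    simp [ctom, ctN]; ring
  have e3 : (ctN μ₁ (ctom μ₃ ζ w)).im < ζ.im / 4 := by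
    have := Complex.abs_im_le_norm (w - ζ)
    rw [e1] at this
    simp only [Complex.neg_im, abs_neg] at this
    exact (le_abs_self _).trans_lt (this.trans_lt hd)
  unfold FPB FPA
  set p := (ctN μ₁ (ctom μ₃ ζ w)).im
  simp only [Complex.sub_im, Complex.neg_im] at e1
  set q := (ctN μ₃ w).im
  have : w.im = ζ.im - p := by linarith
  rw [show p / (ctom μ₃ ζ w).im * (2 + q / w.im) = p * (2 * w.im + q) / ((ctom μ₃ ζ w).im * w.im) by
    field_simp]
  rw [div_lt_one (by positivity), e2]
  rw [this] at hw ⊢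
  have := h.Ypos
  nlinarith [mul_nonneg h2 h1, mul_nonneg h2 (by linarith : 0 ≤ ζ.im - 4 * p)]

lemma norm_aux {k1 k3 : ℂ} {A A' B B' : ℝ} (hA : 0 ≤ A) (hA' : 0 ≤ A') (hB : 0 ≤ B) (hB' : 0 ≤ B')
    (h1 : ‖k1‖ ^ 2 ≤ B * B') (h3 : ‖k3‖ ^ 2 ≤ A * A')
    (hk : B * (2 + A) < 1) (hk' : B' * (2 + A') < 1) :
    ‖k1‖ ≤ 1 ∧ ‖k1 * (2 + k3)‖ ≤ √(B * (2 + A)) := by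
  have b1 : B < 1 := by nlinarith
  have b2 : B' < 1 := by nlinarith
  constructor
  · have : ‖k1‖ ^ 2 ≤ 1 := by nlinarith
    nlinarith [norm_nonneg k1]
  · apply Real.le_sqrt_of_sq_le
    rw [norm_mul, mul_pow]
    have t1 : ‖2 + k3‖ ≤ 2 + ‖k3‖ := (norm_add_le _ _).trans (by simp)
    have t2 : ‖2 + k3‖ ^ 2 ≤ (2 + A) * (2 + A') := by
      have : 2 * ‖k3‖ ≤ A + A' := by
        apply le_of_sq_le_sq _ (by positivity)
        nlinarith [sq_nonneg (A - A')]
      have : ‖2 + k3‖ ^ 2 ≤ (2 + ‖k3‖) ^ 2 := by gcongr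
      nlinarith
    calc ‖k1‖ ^ 2 * ‖2 + k3‖ ^ 2 ≤ (B * B') * ((2 + A) * (2 + A')) := by gcongr
      _ = (B * (2 + A)) * (B' * (2 + A')) := by ring
      _ ≤ (B * (2 + A)) * 1 := by gcongr
      _ = _ := by ring

/-- key two-point relation -/
lemma FP.two (h : FP μ₁ μ₃ σ ζ w) (h' : FP μ₁ μ₃ σ ζ' w')
    (hd : ‖w - ζ‖ < ζ.im / 4) (hd' : ‖w' - ζ'‖ < ζ'.im / 4) :
    (w' - w) * (1 + dslope (ctN μ₁) (ctom μ₃ ζ w) (ctom μ₃ ζ' w') *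
      (2 + dslope (ctN μ₃) w w')) =
      (1 + dslope (ctN μ₁) (ctom μ₃ ζ w) (ctom μ₃ ζ' w')) * (ζ' - ζ) ∧
    ‖dslope (ctN μ₁) (ctom μ₃ ζ w) (ctom μ₃ ζ' w')‖ ≤ 1 ∧
    ‖dslope (ctN μ₁) (ctom μ₃ ζ w) (ctom μ₃ ζ' w') * (2 + dslope (ctN μ₃) w w')‖ ≤
      √(FPB μ₁ μ₃ ζ w * (2 + FPA μ₃ w)) := by
  constructor
  · have e1 := sub_smul_dslope (ctN μ₁) (ctom μ₃ ζ w) (ctom μ₃ ζ' w')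
    have e2 := sub_smul_dslope (ctN μ₃) w w'
    have e3 := h.eq
    have e4 := h'.eq
    set k1 := dslope (ctN μ₁) (ctom μ₃ ζ w) (ctom μ₃ ζ' w')
    set k3 := dslope (ctN μ₃) w w'
    have e5 : ctom μ₃ ζ' w' - ctom μ₃ ζ w =
        (ctN μ₃ w' - ctN μ₃ w) + 2 * (w' - w) - (ζ' - ζ) := by
      simp only [ctom, ctN]; ring
    rw [e5, ← e2] at e1
    simp only [smul_eq_mul] at e1
    linear_combination e4 - e3 + e1
  · have p1 := ctN_pick μ₁ h.om_pos h'.om_pos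
    have p3 := ctN_pick μ₃ h.w_pos h'.w_pos
    obtain ⟨b, a, k⟩ := h.kappa hd
    obtain ⟨b', a', k'⟩ := h'.kappa hd'
    refine norm_aux a a' b b' ?_ ?_ k k'
    · have := h.om_pos
      have := h'.om_pos
      unfold FPB
      rw [div_mul_div_comm, le_div_iff₀ (by positivity)]
      exact p1
    · have := h.w_pos
      have := h'.w_pos
      unfold FPA
      rw [div_mul_div_comm, le_div_iff₀ (by positivity)]
      exact p3

lemma fp_diff (U : Set ℂ) (hU : IsOpen U) (W : ℂ → ℂ) (hW : ∀ ζ ∈ U, FP μ₁ μ₃ σ ζ (W ζ))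
    (hd : ∀ ζ ∈ U, ‖W ζ - ζ‖ < ζ.im / 4) : DifferentiableOn ℂ W U := by
  intro ζ hζ
  apply DifferentiableAt.differentiableWithinAt
  obtain ⟨_, _, hk⟩ := (hW ζ hζ).kappa (hd ζ hζ)
  set κ := √(FPB μ₁ μ₃ ζ (W ζ) * (2 + FPA μ₃ (W ζ))) with hκ
  have hκ1 : κ < 1 := by rw [hκ, Real.sqrt_lt' one_pos]; simpa using hk
  set k1 : ℂ → ℂ := fun x => dslope (ctN μ₁) (ctom μ₃ ζ (W ζ)) (ctom μ₃ x (W x)) with hk1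
  set k3 : ℂ → ℂ := fun x => dslope (ctN μ₃) (W ζ) (W x) with hk3
  have two : ∀ x ∈ U, (W x - W ζ) * (1 + k1 x * (2 + k3 x)) = (1 + k1 x) * (x - ζ) ∧
      ‖k1 x‖ ≤ 1 ∧ ‖k1 x * (2 + k3 x)‖ ≤ κ := fun x hx =>
    (hW ζ hζ).two (hW x hx) (hd ζ hζ) (hd x hx)
  have low : ∀ x ∈ U, 1 - κ ≤ ‖1 + k1 x * (2 + k3 x)‖ := by
    intro x hx
    have := (two x hx).2.2
    have t := norm_sub_norm_le (1 : ℂ) (-(k1 x * (2 + k3 x)))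
    rw [norm_neg, norm_one, sub_neg_eq_add] at t
    linarith
  have hUn : U ∈ nhds ζ := hU.mem_nhds hζ
  have cont : ContinuousAt W ζ := by
    rw [ContinuousAt, tendsto_iff_norm_sub_tendsto_zero]
    have t0 : Tendsto (fun x => 2 / (1 - κ) * ‖x - ζ‖) (nhds ζ) (nhds 0) := by
      have : Tendsto (fun x => 2 / (1 - κ) * ‖x - ζ‖) (nhds ζ) (nhds (2 / (1 - κ) * ‖ζ - ζ‖)) := by
        apply Continuous.tendsto; fun_prop
      simpa using this
    refine squeeze_zero' (Eventually.of_forall fun _ => norm_nonneg _) ?_ t0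
    filter_upwards [hUn] with x hx
    obtain ⟨a, b, c⟩ := two x hx
    have l := low x hx
    have a' := congrArg norm a
    rw [norm_mul, norm_mul] at a'
    have : ‖1 + k1 x‖ ≤ 2 := (norm_add_le _ _).trans (by rw [norm_one]; linarith)
    rw [div_mul_eq_mul_div, le_div_iff₀ (by linarith)]
    calc _ ≤ ‖W x - W ζ‖ * ‖1 + k1 x * (2 + k3 x)‖ := by gcongr
      _ = _ := a'
      _ ≤ _ := by gcongr
  have c3 : ContinuousAt k3 ζ := by
    have : ContinuousAt (dslope (ctN μ₃) (W ζ)) (W ζ) :=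
      continuousAt_dslope_same.2 (ctN_diff μ₃ (hW ζ hζ).w_pos)
    exact ContinuousAt.comp (f := W) this cont
  have c1 : ContinuousAt k1 ζ := by
    have t : ContinuousAt (dslope (ctN μ₁) (ctom μ₃ ζ (W ζ))) (ctom μ₃ ζ (W ζ)) :=
      continuousAt_dslope_same.2 (ctN_diff μ₁ (hW ζ hζ).om_pos)
    have c : ContinuousAt (fun x => ctom μ₃ x (W x)) ζ := by
      unfold ctom
      have := (ct_F_diff μ₃ (hW ζ hζ).w_pos).continuousAt
      have t2 : ContinuousAt (fun x => cauchyF μ₃ (W x)) ζ := ContinuousAt.comp (f := W) this cont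
      exact (t2.add cont).sub continuousAt_id
    exact ContinuousAt.comp (f := fun x => ctom μ₃ x (W x)) t c
  have ne : ∀ x ∈ U, 1 + k1 x * (2 + k3 x) ≠ 0 := by
    intro x hx h0
    have := low x hx
    rw [h0] at this; simp at this; linarith
  have q : ContinuousAt (fun x => (1 + k1 x) / (1 + k1 x * (2 + k3 x))) ζ :=
    ContinuousAt.div (by fun_prop) (by fun_prop) (ne ζ hζ)
  have : HasDerivAt W ((1 + k1 ζ) / (1 + k1 ζ * (2 + k3 ζ))) ζ := by
    rw [hasDerivAt_iff_tendsto_slope]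
    refine (q.tendsto.mono_left (nhdsWithin_le_nhds (s := {ζ}ᶜ))).congr' ?_
    filter_upwards [self_mem_nhdsWithin, mem_nhdsWithin_of_mem_nhds hUn] with x h1 h2
    have h3 : x - ζ ≠ 0 := sub_ne_zero.2 h1
    rw [slope_def_field, div_eq_div_iff (ne x h2) h3, (two x h2).1]
  exact this.differentiableAt

end fixedpoint

section representation

lemma rep_line (φ : ℂ → ℂ) (ε C R0 : ℝ) (hε : 0 < ε)
    (hφ : DifferentiableOn ℂ φ {z : ℂ | -ε < z.im})
    (hb : ∀ t : ℂ, 0 ≤ t.im → R0 ≤ ‖t‖ → ‖φ t‖ * ‖t‖ ^ 2 ≤ C)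
    (hi : Integrable (fun x : ℝ => φ x)) : ∫ x : ℝ, φ x = 0 := by
  have lim := intervalIntegral_tendsto_integral hi tendsto_neg_atTop_atBot tendsto_id
  have lim0 : Tendsto (fun R : ℝ => ∫ x in -R..R, φ x) atTop (nhds 0) := by
    have t0 : Tendsto (fun R : ℝ => 4 * C * R⁻¹) atTop (nhds 0) := by
      simpa using tendsto_inv_atTop_zero.const_mul (4 * C)
    refine squeeze_zero_norm' ?_ t0
    filter_upwards [eventually_ge_atTop R0, eventually_gt_atTop 0] with R hR hR0
    have rect := Complex.integral_boundary_rect_eq_zero_of_differentiableOn φ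
      (⟨-R, 0⟩ : ℂ) (⟨R, R⟩ : ℂ) (hφ.mono (by
        intro z hz
        rw [Complex.mem_reProdIm] at hz
        have := hz.2
        simp only [Set.uIcc_of_le hR0.le, Set.mem_Icc] at this
        simp only [Set.mem_ofPred_eq]; linarith))
    simp only [Complex.ofReal_zero, zero_mul, add_zero, smul_eq_mul] at rect
    have key : ∀ t : ℂ, 0 ≤ t.im → R ≤ ‖t‖ → ‖φ t‖ ≤ C / R ^ 2 := by
      intro t h1 h2
      rw [le_div_iff₀ (by positivity)]
      refine le_trans ?_ (hb t h1 (hR.trans h2))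
      gcongr
    have b1 : ‖∫ x in -R..R, φ (x + (R : ℝ) * Complex.I)‖ ≤ C / R ^ 2 * |R - -R| := by
      refine intervalIntegral.norm_integral_le_of_norm_le_const fun x _ => key _ ?_ ?_
      · simpa using hR0.le
      · have := Complex.abs_im_le_norm (x + (R : ℝ) * Complex.I)
        simp at this
        exact (le_abs_self _).trans this
    have b2 : ‖∫ y in (0:ℝ)..R, φ ((R : ℝ) + y * Complex.I)‖ ≤ C / R ^ 2 * |R - 0| := by
      refine intervalIntegral.norm_integral_le_of_norm_le_const fun y hy => key _ ?_ ?_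
      · rw [Set.uIoc_of_le hR0.le] at hy
        simpa using hy.1.le
      · have := Complex.abs_re_le_norm ((R : ℝ) + y * Complex.I)
        simp at this
        exact (le_abs_self _).trans this
    have b3 : ‖∫ y in (0:ℝ)..R, φ ((-R : ℝ) + y * Complex.I)‖ ≤ C / R ^ 2 * |R - 0| := by
      refine intervalIntegral.norm_integral_le_of_norm_le_const fun y hy => key _ ?_ ?_
      · rw [Set.uIoc_of_le hR0.le] at hy
        simpa using hy.1.le
      · have := Complex.abs_re_le_norm ((-R : ℝ) + y * Complex.I)
        simp at this
        simpa using (le_abs_self _).trans this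
    rw [abs_of_pos (by linarith)] at b1 b2 b3
    have e : ∫ x in -R..R, φ x = (∫ x in -R..R, φ (x + (R : ℝ) * Complex.I)) -
        Complex.I * (∫ y in (0:ℝ)..R, φ ((R : ℝ) + y * Complex.I)) +
        Complex.I * (∫ y in (0:ℝ)..R, φ ((-R : ℝ) + y * Complex.I)) := by
      linear_combination rect
    rw [e]
    refine (norm_add_le _ _).trans ((add_le_add_left (norm_sub_le _ _) _).trans ?_)
    rw [norm_mul, norm_mul, Complex.norm_I, one_mul, one_mul]
    refine (add_le_add (add_le_add b1 b2) b3).trans (le_of_eq ?_)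
    field_simp
    ring
  exact tendsto_nhds_unique lim lim0

lemma kern_eq (z : ℂ) (hz : 0 < z.im) (x : ℝ) :
    ‖((x : ℂ) - z)⁻¹‖ ^ 2 = (z.im ^ 2)⁻¹ * (1 + ((x - z.re) / z.im) ^ 2)⁻¹ := by
  rw [norm_inv, inv_pow, ← Complex.normSq_eq_norm_sq, Complex.normSq_apply, ← mul_inv]
  congr 1
  simp
  field_simp
  ring

lemma kern_int (z : ℂ) (hz : 0 < z.im) : Integrable (fun x : ℝ => ‖((x : ℂ) - z)⁻¹‖ ^ 2) := by
  simp_rw [kern_eq z hz]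
  exact ((integrable_inv_one_add_sq.comp_div hz.ne').comp_sub_right z.re).const_mul _

lemma kern_integral (z : ℂ) (hz : 0 < z.im) :
    ∫ x : ℝ, ‖((x : ℂ) - z)⁻¹‖ ^ 2 = Real.pi / z.im := by
  simp_rw [kern_eq z hz]
  rw [integral_const_mul,
    integral_sub_right_eq_self (fun x : ℝ => (1 + (x / z.im) ^ 2)⁻¹) z.re,
    Measure.integral_comp_div (fun x : ℝ => (1 + x ^ 2)⁻¹) z.im, integral_univ_inv_one_add_sq,
    abs_of_pos hz, smul_eq_mul]
  field_simp

lemma rep_ne (z : ℂ) (hz : 0 < z.im) (x : ℝ) : (x : ℂ) - z ≠ 0 := by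
  rw [← neg_sub]; exact neg_ne_zero.2 (ct_ne hz x)


lemma rep_cont (g : ℂ → ℂ) (ε : ℝ) (hε : 0 < ε)
    (hg : DifferentiableOn ℂ g {z : ℂ | -ε < z.im}) : Continuous fun x : ℝ => g x := by
  have : ContinuousOn g {z : ℂ | -ε < z.im} := hg.continuousOn
  exact this.comp_continuous Complex.continuous_ofReal (by intro x; simpa using hε)

lemma rep_sq_bd (g : ℂ → ℂ) (M : ℝ) (hM : ∀ t : ℂ, 0 ≤ t.im → ‖g t‖ ≤ M)
    (hM2 : ∀ t : ℂ, 0 ≤ t.im → ‖g t‖ * ‖t‖ ≤ M) (x : ℝ) : ‖g x‖ ^ 2 ≤ 2 * M ^ 2 * (1 + x ^ 2)⁻¹ := by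
  have h1 := hM x (by simp)
  have h2 := hM2 x (by simp)
  rw [Complex.norm_real, Real.norm_eq_abs] at h2
  rw [← div_eq_mul_inv, le_div_iff₀ (by positivity)]
  have : ‖g x‖ ^ 2 ≤ M ^ 2 := by gcongr
  have : (‖g x‖ * |x|) ^ 2 ≤ M ^ 2 := by gcongr
  rw [mul_pow, sq_abs] at this
  linarith

lemma rep_int_mul (g : ℂ → ℂ) (ε M : ℝ) (hε : 0 < ε)
    (hg : DifferentiableOn ℂ g {z : ℂ | -ε < z.im}) (hM : ∀ t : ℂ, 0 ≤ t.im → ‖g t‖ ≤ M) (hM2 : ∀ t : ℂ, 0 ≤ t.im → ‖g t‖ * ‖t‖ ≤ M) (z : ℂ) (hz : 0 < z.im) :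
    Integrable (fun x : ℝ => g x * ((x : ℂ) - z)⁻¹) := by
  have c := rep_cont g ε hε hg
  have c2 : Continuous fun x : ℝ => ((x : ℂ) - z)⁻¹ :=
    Continuous.inv₀ (by fun_prop) (rep_ne z hz)
  refine Integrable.mono' ((integrable_inv_one_add_sq.const_mul (2 * M ^ 2)).add (kern_int z hz))
    (c.mul c2).aestronglyMeasurable (ae_of_all _ fun x => ?_)
  rw [norm_mul]
  have := rep_sq_bd g M hM hM2 x
  simp only [Pi.add_apply]
  nlinarith [sq_nonneg (‖g x‖ - ‖((x : ℂ) - z)⁻¹‖), norm_nonneg (g x),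
    norm_nonneg (((x : ℂ) - z)⁻¹)]

lemma conj_norm_eq (z : ℂ) (x : ℝ) :
    ‖((x : ℂ) - (starRingEnd ℂ) z)⁻¹‖ = ‖((x : ℂ) - z)⁻¹‖ := by
  rw [← Complex.norm_conj (((x : ℂ) - z)⁻¹)]
  simp

lemma rep_int_mul' (g : ℂ → ℂ) (ε M : ℝ) (hε : 0 < ε)
    (hg : DifferentiableOn ℂ g {z : ℂ | -ε < z.im}) (hM : ∀ t : ℂ, 0 ≤ t.im → ‖g t‖ ≤ M) (hM2 : ∀ t : ℂ, 0 ≤ t.im → ‖g t‖ * ‖t‖ ≤ M) (z : ℂ) (hz : 0 < z.im) :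
    Integrable (fun x : ℝ => g x * ((x : ℂ) - (starRingEnd ℂ) z)⁻¹) := by
  have c := rep_cont g ε hε hg
  have c2 : Continuous fun x : ℝ => ((x : ℂ) - (starRingEnd ℂ) z)⁻¹ := by
    have : Continuous fun x : ℝ => (starRingEnd ℂ) ((x : ℂ) - z)⁻¹ :=
      Complex.continuous_conj.comp (Continuous.inv₀ (by fun_prop) (rep_ne z hz))
    simpa using this
  refine Integrable.mono (rep_int_mul g ε M hε hg hM hM2 z hz) (c.mul c2).aestronglyMeasurable
    (ae_of_all _ fun x => le_of_eq ?_)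
  rw [norm_mul, norm_mul, conj_norm_eq]

lemma big_bd (z t : ℂ) (h : 2 * ‖z‖ + 1 ≤ ‖t‖) : ‖(t - z)⁻¹‖ * ‖t‖ ≤ 2 := by
  have h1 : ‖t‖ - ‖z‖ ≤ ‖t - z‖ := norm_sub_norm_le _ _
  have h0 := norm_nonneg z
  rw [norm_inv, inv_mul_eq_div, div_le_iff₀ (by linarith)]
  linarith

lemma rep_lower (g : ℂ → ℂ) (ε M : ℝ) (hε : 0 < ε)
    (hg : DifferentiableOn ℂ g {z : ℂ | -ε < z.im}) (hM : ∀ t : ℂ, 0 ≤ t.im → ‖g t‖ ≤ M) (hM2 : ∀ t : ℂ, 0 ≤ t.im → ‖g t‖ * ‖t‖ ≤ M) (z : ℂ) (hz : 0 < z.im) :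
    ∫ x : ℝ, g x * ((x : ℂ) - (starRingEnd ℂ) z)⁻¹ = 0 := by
  refine rep_line (fun t => g t * (t - (starRingEnd ℂ) z)⁻¹) (min ε z.im) (M * 2) (2 * ‖z‖ + 1)
    (lt_min hε hz) ?_ ?_ (rep_int_mul' g ε M hε hg hM hM2 z hz)
  · intro t ht
    simp only [Set.mem_ofPred_eq] at ht
    have t1 : -ε < t.im := by have := min_le_left ε z.im; linarith
    have t2 : -z.im < t.im := by have := min_le_right ε z.im; linarith
    have op : IsOpen {z : ℂ | -ε < z.im} := isOpen_lt continuous_const Complex.continuous_im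
    have d1 := hg.differentiableAt (op.mem_nhds t1)
    have : t - (starRingEnd ℂ) z ≠ 0 := by
      intro h
      have := congrArg Complex.im h
      simp at this; linarith
    exact (d1.mul ((differentiableAt_id.sub_const _).inv this)).differentiableWithinAt
  · intro t h1 h2
    have a1 := hM2 t h1
    have a2 := big_bd ((starRingEnd ℂ) z) t (by rwa [Complex.norm_conj])
    have : 0 ≤ M := (norm_nonneg _).trans (hM t h1)
    rw [norm_mul]
    calc _ = (‖g t‖ * ‖t‖) * (‖(t - (starRingEnd ℂ) z)⁻¹‖ * ‖t‖) := by ring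
      _ ≤ _ := by gcongr

lemma rep_upper (g : ℂ → ℂ) (ε M : ℝ) (hε : 0 < ε)
    (hg : DifferentiableOn ℂ g {z : ℂ | -ε < z.im}) (hM : ∀ t : ℂ, 0 ≤ t.im → ‖g t‖ ≤ M) (hM2 : ∀ t : ℂ, 0 ≤ t.im → ‖g t‖ * ‖t‖ ≤ M) (z : ℂ) (hz : 0 < z.im) :
    ∫ x : ℝ, g x * ((x : ℂ) - z)⁻¹ = 2 * Real.pi * Complex.I * g z := by
  have op : IsOpen {z : ℂ | -ε < z.im} := isOpen_lt continuous_const Complex.continuous_im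
  have zm : z ∈ {z : ℂ | -ε < z.im} := by simp only [Set.mem_ofPred_eq]; linarith
  have id1 : ∀ t : ℂ, t ≠ z → t ≠ (starRingEnd ℂ) z →
      dslope g z t + g z * (t - (starRingEnd ℂ) z)⁻¹ = g t * (t - z)⁻¹ -
        g z * (2 * z.im * Complex.I) * ((t - z)⁻¹ * (t - (starRingEnd ℂ) z)⁻¹) := by
    intro t h1 h2
    have n1 : t - z ≠ 0 := sub_ne_zero.2 h1
    have n2 : t - (starRingEnd ℂ) z ≠ 0 := sub_ne_zero.2 h2
    have e : (2 * z.im * Complex.I : ℂ) = z - (starRingEnd ℂ) z := by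
      rw [Complex.sub_conj]; push_cast; ring
    rw [dslope_of_ne _ h1, slope_def_field, e]
    field_simp
    ring
  have nx : ∀ x : ℝ, (x : ℂ) ≠ z := fun x => sub_ne_zero.1 (rep_ne z hz x)
  have nx' : ∀ x : ℝ, (x : ℂ) ≠ (starRingEnd ℂ) z := by
    intro x h
    have := congrArg Complex.im h
    simp at this; linarith
  have id2 : ∀ x : ℝ, ((x : ℂ) - z)⁻¹ * ((x : ℂ) - (starRingEnd ℂ) z)⁻¹ =
      ((‖((x : ℂ) - z)⁻¹‖ ^ 2 : ℝ) : ℂ) := by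
    intro x
    rw [← Complex.normSq_eq_norm_sq, ← Complex.mul_conj]
    simp
  have id3 : ∀ x : ℝ, dslope g z x + g z * ((x : ℂ) - (starRingEnd ℂ) z)⁻¹ = g x * ((x : ℂ) - z)⁻¹ -
        g z * (2 * z.im * Complex.I) * ((‖((x : ℂ) - z)⁻¹‖ ^ 2 : ℝ) : ℂ) := by
    intro x
    rw [id1 _ (nx x) (nx' x), id2]
  have i1 := rep_int_mul g ε M hε hg hM hM2 z hz
  have i2 : Integrable (fun x : ℝ => ((‖((x : ℂ) - z)⁻¹‖ ^ 2 : ℝ) : ℂ)) := (kern_int z hz).ofReal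
  have line := rep_line (fun t => dslope g z t + g z * (t - (starRingEnd ℂ) z)⁻¹) (min ε z.im)
    (M * 2 + ‖g z‖ * (2 * z.im) * (2 * 2)) (2 * ‖z‖ + 1) (lt_min hε hz) ?_ ?_ ?_
  · simp_rw [id3] at line
    rw [integral_sub i1 (i2.const_mul _), integral_const_mul, integral_complex_ofReal,
      kern_integral z hz, sub_eq_zero] at line
    rw [line]
    have : (z.im : ℂ) ≠ 0 := by exact_mod_cast hz.ne'
    push_cast
    field_simp
  · apply DifferentiableOn.add
    · have := (Complex.differentiableOn_dslope (op.mem_nhds zm)).2 hg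
      refine this.mono fun t ht => ?_
      simp only [Set.mem_ofPred_eq] at ht ⊢
      have := min_le_left ε z.im; linarith
    · intro t ht
      simp only [Set.mem_ofPred_eq] at ht
      have t2 : -z.im < t.im := by have := min_le_right ε z.im; linarith
      have : t - (starRingEnd ℂ) z ≠ 0 := by
        intro h
        have := congrArg Complex.im h
        simp at this; linarith
      have d : DifferentiableAt ℂ (fun t => (t - (starRingEnd ℂ) z)⁻¹) t :=
        (differentiableAt_id.sub_const _).inv this
      exact (d.const_mul _).differentiableWithinAt
  · intro t h1 h2
    have z0 := norm_nonneg z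
    have n1 : t ≠ z := by rintro rfl; linarith
    have n2 : t ≠ (starRingEnd ℂ) z := by
      rintro rfl; rw [Complex.norm_conj] at h2; linarith
    rw [id1 t n1 n2]
    have a1 := hM2 t h1
    have a2 := big_bd ((starRingEnd ℂ) z) t (by rwa [Complex.norm_conj])
    have a3 := big_bd z t h2
    have : 0 ≤ M := (norm_nonneg _).trans (hM t h1)
    have nn : ‖(2 * z.im * Complex.I : ℂ)‖ = 2 * z.im := by
      simp [abs_of_pos hz]
    calc _ ≤ (‖g t * (t - z)⁻¹‖ + ‖g z * (2 * z.im * Complex.I) *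
          ((t - z)⁻¹ * (t - (starRingEnd ℂ) z)⁻¹)‖) * ‖t‖ ^ 2 := by
          gcongr; exact norm_sub_le _ _
      _ = (‖g t‖ * ‖t‖) * (‖(t - z)⁻¹‖ * ‖t‖) + ‖g z‖ * (2 * z.im) *
          ((‖(t - z)⁻¹‖ * ‖t‖) * (‖(t - (starRingEnd ℂ) z)⁻¹‖ * ‖t‖)) := by
          rw [norm_mul (g t), norm_mul (g z * _), norm_mul (g z), nn, norm_mul (t - z)⁻¹]; ring
      _ ≤ _ := by gcongr
  · simp_rw [id3]
    exact i1.sub (i2.const_mul _)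

lemma rep_formula (g : ℂ → ℂ) (ε M : ℝ) (hε : 0 < ε)
    (hg : DifferentiableOn ℂ g {z : ℂ | -ε < z.im}) (hM : ∀ t : ℂ, 0 ≤ t.im → ‖g t‖ ≤ M) (hM2 : ∀ t : ℂ, 0 ≤ t.im → ‖g t‖ * ‖t‖ ≤ M) (z : ℂ) (hz : 0 < z.im) :
    ∫ x : ℝ, ((-(g x).im / Real.pi : ℝ) : ℂ) * (z - (x : ℂ))⁻¹ = g z := by
  have u := rep_upper g ε M hε hg hM hM2 z hz
  have l := rep_lower g ε M hε hg hM hM2 z hz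
  have i1 := rep_int_mul g ε M hε hg hM hM2 z hz
  have i2 := rep_int_mul' g ε M hε hg hM hM2 z hz
  have l' := congrArg (starRingEnd ℂ) l
  rw [← integral_conj] at l'
  simp only [map_mul, map_inv₀, map_sub, Complex.conj_conj, Complex.conj_ofReal, map_zero] at l'
  have i2' : Integrable (fun x : ℝ => (starRingEnd ℂ) (g x) * ((x : ℂ) - z)⁻¹) := by
    have : Integrable (fun x : ℝ => Complex.conjCLE (g x * ((x : ℂ) - (starRingEnd ℂ) z)⁻¹)) :=
      Complex.conjCLE.integrable_comp_iff.2 i2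
    simpa using this
  have e : ∀ x : ℝ, ((-(g x).im / Real.pi : ℝ) : ℂ) * (z - (x : ℂ))⁻¹ =
      (2 * Real.pi * Complex.I)⁻¹ *
        (g x * ((x : ℂ) - z)⁻¹ - (starRingEnd ℂ) (g x) * ((x : ℂ) - z)⁻¹) := by
    intro x
    rw [← sub_mul, Complex.sub_conj, ← neg_sub, inv_neg]
    have := rep_ne z hz x
    have : (Real.pi : ℂ) ≠ 0 := by exact_mod_cast Real.pi_ne_zero
    have := Complex.I_ne_zero
    push_cast
    field_simp
  simp_rw [e]
  rw [integral_const_mul, integral_sub i1 i2', u, l']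
  have : (Real.pi : ℂ) ≠ 0 := by exact_mod_cast Real.pi_ne_zero
  have := Complex.I_ne_zero
  field_simp
  ring



end representation

section final

lemma rep_measure (F : ℂ → ℂ) (B δ : ℝ) (hδ : 0 < δ)
    (hF : DifferentiableOn ℂ F {z : ℂ | 0 < z.im})
    (hB : ∀ z : ℂ, 0 < z.im → ‖F z - z‖ ≤ B) (hd : ∀ z : ℂ, 0 < z.im → δ ≤ (F z).im) :
    ∃ μ : Measure ℝ, IsProbabilityMeasure μ ∧ ∀ z : ℂ, 0 < z.im → cauchyG μ z = (F z)⁻¹ := by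
  have B0 : 0 ≤ B := (norm_nonneg _).trans (hB Complex.I (by simp))
  have op : IsOpen {z : ℂ | 0 < z.im} := isOpen_lt continuous_const Complex.continuous_im
  have normF : ∀ z : ℂ, 0 < z.im → δ ≤ ‖F z‖ := fun z hz =>
    (hd z hz).trans ((le_abs_self _).trans (Complex.abs_im_le_norm _))
  have Fne : ∀ z : ℂ, 0 < z.im → F z ≠ 0 := fun z hz h0 => by
    have := normF z hz; rw [h0, norm_zero] at this; linarith
  set ε : ℕ → ℝ := fun n => 1 / ((n : ℝ) + 1) with hε
  have ε0 : ∀ n, 0 < ε n := fun n => by simp only [hε]; positivity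
  have ε1 : ∀ n, ε n ≤ 1 := fun n => by
    simp only [hε]; rw [div_le_one (by positivity)]; linarith [(Nat.cast_nonneg n : (0:ℝ) ≤ n)]
  set g : ℕ → ℂ → ℂ := fun n t => (F (t + ε n * Complex.I))⁻¹ with hgdef
  have shim : ∀ n (t : ℂ), (t + ε n * Complex.I).im = t.im + ε n := by intro n t; simp
  have shpos : ∀ n (t : ℂ), 0 ≤ t.im → 0 < (t + ε n * Complex.I).im := by
    intro n t ht; rw [shim]; linarith [ε0 n]
  have hg : ∀ n, DifferentiableOn ℂ (g n) {z : ℂ | -ε n < z.im} := by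
    intro n t ht
    simp only [Set.mem_ofPred_eq] at ht
    have p : 0 < (t + ε n * Complex.I).im := by rw [shim]; linarith
    have d := hF.differentiableAt (op.mem_nhds p)
    have d2 : DifferentiableAt ℂ (fun t : ℂ => F (t + ε n * Complex.I)) t :=
      DifferentiableAt.comp (f := fun t : ℂ => t + ε n * Complex.I) t d (by fun_prop)
    exact (d2.inv (Fne _ p)).differentiableWithinAt
  have close : ∀ n (t : ℂ), 0 ≤ t.im → ‖F (t + ε n * Complex.I) - t‖ ≤ B + 1 := by
    intro n t ht
    have h1 := hB _ (shpos n t ht)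
    have : F (t + ε n * Complex.I) - t =
      (F (t + ε n * Complex.I) - (t + ε n * Complex.I)) + ε n * Complex.I := by ring
    rw [this]
    refine (norm_add_le _ _).trans (add_le_add h1 ?_)
    simp [abs_of_pos (ε0 n), ε1 n]
  set M : ℝ := 1 / δ + 1 + (B + 1) / δ with hMdef
  have gle : ∀ n (t : ℂ), 0 ≤ t.im → ‖g n t‖ ≤ 1 / δ := by
    intro n t ht
    simp only [hgdef, norm_inv, one_div]
    have := normF _ (shpos n t ht)
    gcongr
  have hM : ∀ n (t : ℂ), 0 ≤ t.im → ‖g n t‖ ≤ M := by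
    intro n t ht
    refine (gle n t ht).trans ?_
    have : 0 ≤ (B + 1) / δ := by positivity
    rw [hMdef]; linarith
  have hM2 : ∀ n (t : ℂ), 0 ≤ t.im → ‖g n t‖ * ‖t‖ ≤ M := by
    intro n t ht
    have h1 := close n t ht
    have h2 : ‖t‖ ≤ ‖F (t + ε n * Complex.I)‖ + (B + 1) := by
      have := norm_sub_norm_le t (F (t + ε n * Complex.I))
      rw [norm_sub_rev] at this; linarith
    have h3 : ‖g n t‖ * ‖F (t + ε n * Complex.I)‖ = 1 := by
      rw [← norm_mul]; simp [hgdef, Fne _ (shpos n t ht)]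
    calc _ ≤ ‖g n t‖ * (‖F (t + ε n * Complex.I)‖ + (B + 1)) := by gcongr
      _ = 1 + ‖g n t‖ * (B + 1) := by rw [mul_add, h3]
      _ ≤ 1 + 1 / δ * (B + 1) := by have := gle n t ht; gcongr
      _ ≤ M := by
        have : 0 ≤ 1 / δ := by positivity
        rw [hMdef]
        have : 1 / δ * (B + 1) = (B + 1) / δ := by ring
        linarith
  have M0 : 0 ≤ M := (norm_nonneg _).trans (hM 0 0 (by simp))
  set ρ : ℕ → ℝ → ℝ := fun n x => -(g n x).im / Real.pi with hρ
  have ρeq : ∀ n (x : ℝ), -(g n x).im = (F (x + ε n * Complex.I)).im * ‖g n x‖ ^ 2 := by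
    intro n x
    simp [hgdef, Complex.inv_im, Complex.normSq_eq_norm_sq]
    ring
  have ρ0 : ∀ n x, 0 ≤ ρ n x := by
    intro n x
    simp only [hρ]
    rw [ρeq]
    have := hd _ (shpos n x (by simp))
    have := Real.pi_pos
    have : 0 ≤ (F (x + ε n * Complex.I)).im := by linarith
    positivity
  set D : ℝ := (B + 1) * (2 * M ^ 2) / Real.pi with hD
  have D0 : 0 ≤ D := by have := Real.pi_pos; positivity
  have ρle : ∀ n x, ρ n x ≤ D * (1 + x ^ 2)⁻¹ := by
    intro n x
    simp only [hρ, hD]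
    rw [ρeq, div_mul_eq_mul_div]
    have := Real.pi_pos
    have h1 := rep_sq_bd (g n) M (hM n) (hM2 n) x
    have h2 : (F (x + ε n * Complex.I)).im ≤ B + 1 := by
      have := close n x (by simp)
      have h := (le_abs_self _).trans (Complex.abs_im_le_norm (F (x + ε n * Complex.I) - x))
      simp only [Complex.sub_im, Complex.ofReal_im, sub_zero] at h
      linarith
    rw [mul_assoc (B + 1)]
    gcongr
  have ρc : ∀ n, Continuous (ρ n) := by
    intro n
    have := rep_cont (g n) (ε n) (ε0 n) (hg n)
    have h2 : Continuous fun x : ℝ => (g n x).im := Complex.continuous_im.comp this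
    simp only [hρ]
    fun_prop
  have Dint : Integrable (fun x : ℝ => D * (1 + x ^ 2)⁻¹) := integrable_inv_one_add_sq.const_mul D
  have ρi : ∀ n, Integrable (ρ n) := fun n => by
    refine Dint.mono' (ρc n).aestronglyMeasurable (ae_of_all _ fun x => ?_)
    rw [Real.norm_of_nonneg (ρ0 n x)]
    exact ρle n x
  have form : ∀ n (z : ℂ), 0 < z.im → ∫ x : ℝ, ((ρ n x : ℝ) : ℂ) * (z - (x : ℂ))⁻¹ = g n z :=
    fun n z hz => rep_formula (g n) (ε n) M (ε0 n) (hg n) (hM n) (hM2 n) z hz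
  have mass : ∀ n, ∫ x, ρ n x = 1 := by
    intro n
    have t1 : Tendsto (fun y : ℝ => ∫ x : ℝ, ((ρ n x : ℝ) : ℂ) *
        ((Complex.I * y) * (Complex.I * y - (x : ℂ))⁻¹)) atTop
        (nhds (∫ x : ℝ, ((ρ n x : ℝ) : ℂ))) := by
      refine tendsto_integral_filter_of_dominated_convergence (ρ n) ?_ ?_ (ρi n) ?_
      · filter_upwards [eventually_gt_atTop 0] with y hy
        have c := ct_cont (a := Complex.I * y) (by simpa using hy)
        have := ρc n
        have : Continuous fun x : ℝ => ((ρ n x : ℝ) : ℂ) *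
          ((Complex.I * y) * (Complex.I * y - (x : ℂ))⁻¹) := by fun_prop
        exact this.aestronglyMeasurable
      · filter_upwards [eventually_gt_atTop 0] with y hy
        refine ae_of_all _ fun x => ?_
        have b := ct_bound (a := Complex.I * y) (by simpa using hy) x
        have hn : ‖(Complex.I * y : ℂ)‖ = y := by simp [abs_of_pos hy]
        have him : (Complex.I * y : ℂ).im = y := by simp
        rw [him] at b
        rw [norm_mul, norm_mul, hn, Complex.norm_real, Real.norm_of_nonneg (ρ0 n x)]
        have : y * ‖(Complex.I * y - (x : ℂ))⁻¹‖ ≤ 1 := by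
          calc _ ≤ y * y⁻¹ := by gcongr
            _ = 1 := mul_inv_cancel₀ hy.ne'
        calc _ ≤ ρ n x * 1 := by have := ρ0 n x; gcongr
          _ = _ := mul_one _
      · refine ae_of_all _ fun x => ?_
        have : Tendsto (fun y : ℝ => (Complex.I * y) * (Complex.I * y - (x : ℂ))⁻¹) atTop
            (nhds 1) := by
          rw [tendsto_iff_norm_sub_tendsto_zero]
          have t0 : Tendsto (fun y : ℝ => |x| * y⁻¹) atTop (nhds 0) := by
            simpa using tendsto_inv_atTop_zero.const_mul |x|
          refine squeeze_zero' (Eventually.of_forall fun _ => norm_nonneg _) ?_ t0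
          filter_upwards [eventually_gt_atTop 0] with y hy
          have b := ct_bound (a := Complex.I * y) (by simpa using hy) x
          have him : (Complex.I * y : ℂ).im = y := by simp
          rw [him] at b
          have nz := ct_ne (a := Complex.I * y) (by simpa using hy) x
          have : (Complex.I * y) * (Complex.I * y - (x : ℂ))⁻¹ - 1 =
            x * (Complex.I * y - (x : ℂ))⁻¹ := by field_simp; ring
          rw [this, norm_mul, Complex.norm_real, Real.norm_eq_abs]
          gcongr
        simpa using this.const_mul ((ρ n x : ℝ) : ℂ)
    have t2 : Tendsto (fun y : ℝ => ∫ x : ℝ, ((ρ n x : ℝ) : ℂ) *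
        ((Complex.I * y) * (Complex.I * y - (x : ℂ))⁻¹)) atTop (nhds 1) := by
      rw [tendsto_iff_norm_sub_tendsto_zero]
      have t0 : Tendsto (fun y : ℝ => (M * (B + 1)) * y⁻¹) atTop (nhds 0) := by
        simpa using tendsto_inv_atTop_zero.const_mul (M * (B + 1))
      refine squeeze_zero' (Eventually.of_forall fun _ => norm_nonneg _) ?_ t0
      filter_upwards [eventually_gt_atTop 0] with y hy
      have hyi : 0 < (Complex.I * y : ℂ).im := by simpa using hy
      have e : ∫ x : ℝ, ((ρ n x : ℝ) : ℂ) * ((Complex.I * y) * (Complex.I * y - (x : ℂ))⁻¹) =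
          (Complex.I * y) * g n (Complex.I * y) := by
        rw [← form n _ hyi, ← integral_const_mul]
        congr 1; ext x; ring
      rw [e]
      have c := close n (Complex.I * y) hyi.le
      have m := hM2 n (Complex.I * y) hyi.le
      have hn : ‖(Complex.I * y : ℂ)‖ = y := by simp [abs_of_pos hy]
      rw [hn] at m
      have e2 : (Complex.I * y) * g n (Complex.I * y) - 1 =
          - (g n (Complex.I * y) * (F (Complex.I * y + ε n * Complex.I) - Complex.I * y)) := by
        have h3 : g n (Complex.I * y) * F (Complex.I * y + ε n * Complex.I) = 1 := by
          simp [hgdef, Fne _ (shpos n _ hyi.le)]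
        rw [mul_sub, h3]; ring
      rw [e2, norm_neg, norm_mul]
      have m' : ‖g n (Complex.I * y)‖ ≤ M * y⁻¹ := by
        rw [← div_eq_mul_inv, le_div_iff₀ hy]; exact m
      calc _ ≤ (M * y⁻¹) * (B + 1) := by gcongr
        _ = _ := by ring
    have := tendsto_nhds_unique t1 t2
    rw [integral_complex_ofReal] at this
    exact_mod_cast this
  set ν : ℕ → Measure ℝ := fun n => volume.withDensity fun x => ENNReal.ofReal (ρ n x) with hν
  have νp : ∀ n, IsProbabilityMeasure (ν n) := by
    intro n
    constructor
    simp only [hν]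
    rw [withDensity_apply _ MeasurableSet.univ, Measure.restrict_univ,
      ← ofReal_integral_eq_lintegral_ofReal (ρi n) (ae_of_all _ (ρ0 n)), mass n]
    simp
  have νG : ∀ n (z : ℂ), 0 < z.im → ∫ x, (z - (x : ℂ))⁻¹ ∂(ν n) = g n z := by
    intro n z hz
    simp only [hν]
    rw [integral_withDensity_eq_integral_toReal_smul (ρc n).measurable.ennreal_ofReal
      (ae_of_all _ fun x => ENNReal.ofReal_lt_top), ← form n z hz]
    congr 1; ext x
    rw [ENNReal.toReal_ofReal (ρ0 n x), Complex.real_smul]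
  set P : ℕ → ProbabilityMeasure ℝ := fun n => ⟨ν n, νp n⟩ with hP
  have fin : IsFiniteMeasure (volume.withDensity fun x : ℝ => ENNReal.ofReal (D * (1 + x ^ 2)⁻¹)) :=
    isFiniteMeasure_withDensity_ofReal Dint.2
  have tight : IsTightMeasureSet {((μ : ProbabilityMeasure ℝ) : Measure ℝ) | μ ∈ Set.range P} := by
    rw [isTightMeasureSet_iff_exists_isCompact_measure_compl_le]
    intro e he
    obtain ⟨K, hK, hK2⟩ := isTightMeasureSet_iff_exists_isCompact_measure_compl_le.1
      (isTightMeasureSet_singleton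
        (μ := volume.withDensity fun x : ℝ => ENNReal.ofReal (D * (1 + x ^ 2)⁻¹))) e he
    refine ⟨K, hK, ?_⟩
    rintro _ ⟨_, ⟨n, rfl⟩, rfl⟩
    refine le_trans ?_ (hK2 _ rfl)
    have : ν n ≤ volume.withDensity fun x : ℝ => ENNReal.ofReal (D * (1 + x ^ 2)⁻¹) :=
      withDensity_mono (ae_of_all _ fun x => ENNReal.ofReal_le_ofReal (ρle n x))
    exact this _
  have comp := isCompact_closure_of_isTightMeasureSet tight
  set U : Ultrafilter ℕ := Ultrafilter.of atTop with hU
  have Ule : (U : Filter ℕ) ≤ atTop := Ultrafilter.of_le atTop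
  obtain ⟨m, -, hm⟩ := comp.ultrafilter_le_nhds (U.map P) (by
    rw [le_principal_iff]
    exact Filter.mem_of_superset (Filter.mem_map.2 (Filter.univ_mem' fun n => Set.mem_range_self n))
      subset_closure)
  have hm' : Tendsto P U (nhds m) := hm
  refine ⟨m, inferInstance, fun z hz => ?_⟩
  have key := (ProbabilityMeasure.tendsto_iff_forall_integral_rclike_tendsto ℂ).1 hm'
    (BoundedContinuousFunction.ofNormedAddCommGroup (fun x : ℝ => (z - (x : ℂ))⁻¹) (ct_cont hz)
      z.im⁻¹ (ct_bound hz))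
  have k2 : Tendsto (fun n => g n z) U (nhds (cauchyG m z)) := by
    refine key.congr fun n => ?_
    exact νG n z hz
  have k3 : Tendsto (fun n => g n z) atTop (nhds (F z)⁻¹) := by
    have c : ContinuousAt (fun t => (F t)⁻¹) z :=
      (hF.differentiableAt (op.mem_nhds hz)).continuousAt.inv₀ (Fne z hz)
    have l : Tendsto (fun n => z + (ε n : ℂ) * Complex.I) atTop (nhds z) := by
      have h0 : Tendsto (fun n => ((ε n : ℝ) : ℂ)) atTop (nhds ((0 : ℝ) : ℂ)) :=
        (Complex.continuous_ofReal.tendsto 0).comp tendsto_one_div_add_atTop_nhds_zero_nat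
      simpa using (h0.mul_const Complex.I).const_add z
    exact c.tendsto.comp l
  exact tendsto_nhds_unique k2 (k3.mono_left Ule)

end final

/-- Let `w₃(ζ)` denote the unique fixed point of `T_ζ` in
`{Im w > (3/4)·Im ζ}` for `Im ζ > 2√2·σ₁`. Then `F̃(z) = F_{μ₃}(w₃(z + 2√2·σ₁·i))` is
holomorphic on `ℂ⁺` with values in `ℂ⁺`, `F̃(iy)/(iy) → 1` as `y → ∞`, and `F̃` is the
reciprocal Cauchy transform of some probability measure `μ̃` on `ℝ`. -/
theorem deconvolution_defines_measure (μ₁ μ₃ : Measure ℝ)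
    [IsProbabilityMeasure μ₁] [IsProbabilityMeasure μ₃]
    (hμ₁mom : Integrable (fun t : ℝ => t ^ 2) μ₁)
    (hμ₃mom : Integrable (fun t : ℝ => t ^ 2) μ₃)
    (σ₁ : ℝ) (hσ₁ : 0 < σ₁)
    (hmean₁ : (∫ t, t ∂μ₁) = 0)
    (hvar₁ : (∫ t, t ^ 2 ∂μ₁) = σ₁ ^ 2)
    (w₃ : ℂ → ℂ)
    (hw₃ : ∀ ζ : ℂ, 2 * Real.sqrt 2 * σ₁ < ζ.im →
      3 / 4 * ζ.im < (w₃ ζ).im ∧ Tadd μ₁ μ₃ ζ (w₃ ζ) = w₃ ζ) :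
    DifferentiableOn ℂ
        (fun z : ℂ => cauchyF μ₃ (w₃ (z + 2 * Real.sqrt 2 * σ₁ * Complex.I)))
        {z : ℂ | 0 < z.im} ∧
      (∀ z : ℂ, 0 < z.im →
        0 < (cauchyF μ₃ (w₃ (z + 2 * Real.sqrt 2 * σ₁ * Complex.I))).im) ∧
      Tendsto
        (fun y : ℝ =>
          cauchyF μ₃ (w₃ (Complex.I * y + 2 * Real.sqrt 2 * σ₁ * Complex.I)) /
            (Complex.I * y))
        atTop (nhds 1) ∧
      ∃ μt : Measure ℝ, IsProbabilityMeasure μt ∧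
        ∀ z : ℂ, 0 < z.im →
          cauchyG μt z =
            (cauchyF μ₃ (w₃ (z + 2 * Real.sqrt 2 * σ₁ * Complex.I)))⁻¹ := by
  set c : ℝ := 2 * Real.sqrt 2 * σ₁ with hc
  have cpos : 0 < c := by positivity
  have csq : c ^ 2 = 8 * σ₁ ^ 2 := by
    rw [hc, mul_pow, mul_pow, Real.sq_sqrt (by norm_num)]; ring
  have ec : (2 * (Real.sqrt 2 : ℂ) * (σ₁ : ℂ) * Complex.I) = (c : ℂ) * Complex.I := by
    rw [hc]; push_cast; ring
  simp only [ec]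
  have hFP : ∀ ζ : ℂ, c < ζ.im → FP μ₁ μ₃ σ₁ ζ (w₃ ζ) := fun ζ hζ =>
    ⟨cpos.trans hζ, by nlinarith, (hw₃ ζ hζ).1, (hw₃ ζ hζ).2⟩
  have him : ∀ z : ℂ, (z + (c : ℂ) * Complex.I).im = z.im + c := fun z => by simp
  have hlt : ∀ z : ℂ, 0 < z.im → c < (z + (c : ℂ) * Complex.I).im := fun z hz => by
    rw [him]; linarith
  have hdiffW : DifferentiableOn ℂ w₃ {ζ : ℂ | c < ζ.im} := by
    refine fp_diff {ζ : ℂ | c < ζ.im}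
      (isOpen_lt continuous_const Complex.continuous_im) w₃ (fun ζ hζ => hFP ζ hζ) ?_
    intro ζ hζ
    exact (hFP ζ hζ).dist hμ₁mom hmean₁ hvar₁
  have hdiff : DifferentiableOn ℂ (fun z : ℂ => cauchyF μ₃ (w₃ (z + (c : ℂ) * Complex.I)))
      {z : ℂ | 0 < z.im} := by
    intro z hz
    have h1 := hlt z hz
    have h2 : DifferentiableAt ℂ w₃ (z + (c : ℂ) * Complex.I) :=
      (hdiffW _ h1).differentiableAt
        ((isOpen_lt continuous_const Complex.continuous_im).mem_nhds h1)
    have h3 : DifferentiableAt ℂ (fun z : ℂ => z + (c : ℂ) * Complex.I) z := by fun_prop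
    have h4 := ct_F_diff μ₃ (hFP _ h1).w_pos
    have h5 : DifferentiableAt ℂ (fun z : ℂ => w₃ (z + (c : ℂ) * Complex.I)) z :=
      DifferentiableAt.comp (g := w₃) z h2 h3
    exact (DifferentiableAt.comp (g := cauchyF μ₃) z h4 h5).differentiableWithinAt
  have hw : ∀ z : ℂ, 0 < z.im → 3 / 4 * c ≤ (w₃ (z + (c : ℂ) * Complex.I)).im := by
    intro z hz
    have h1 := (hFP _ (hlt z hz)).im_w
    rw [him] at h1; linarith
  have hlow : ∀ z : ℂ, 0 < z.im →
      3 / 4 * c ≤ (cauchyF μ₃ (w₃ (z + (c : ℂ) * Complex.I))).im := by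
    intro z hz
    exact (hw z hz).trans (ct_F_im μ₃ (hFP _ (hlt z hz)).w_pos)
  obtain ⟨B, hB⟩ : ∃ B : ℝ, ∀ z : ℂ, 0 < z.im →
      ‖cauchyF μ₃ (w₃ (z + (c : ℂ) * Complex.I)) - z‖ ≤ B := by
    set m : ℝ := ∫ t, t ∂μ₃ with hm
    set V : ℝ := ∫ t, (t - m) ^ 2 ∂μ₃ with hV
    refine ⟨c / 4 + c + (|m| + V / (3 / 4 * c)), fun z hz => ?_⟩
    set ζ : ℂ := z + (c : ℂ) * Complex.I with hζ
    have hf := hFP ζ (hlt z hz)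
    have b1 : ‖w₃ ζ - ζ‖ ≤ c / 4 := by
      have hb := ct_h_bound μ₁ hμ₁mom hf.om_pos
      simp only [hmean₁, sub_zero, hvar₁, Complex.ofReal_zero] at hb
      have e : hTrans μ₁ (ctom μ₃ ζ (w₃ ζ)) = w₃ ζ - ζ := by rw [hf.eq]; simp [hTrans, ctN]
      rw [e] at hb
      have h1 := hf.om_im
      have h2 := hlt z hz
      have h3 : c / 2 ≤ (ctom μ₃ ζ (w₃ ζ)).im := by linarith
      have h4 := mul_le_mul_of_nonneg_left h3 (norm_nonneg (w₃ ζ - ζ))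
      by_contra! h5
      nlinarith
    have b2 : ‖hTrans μ₃ (w₃ ζ)‖ ≤ |m| + V / (3 / 4 * c) := by
      have hb := ct_h_bound μ₃ hμ₃mom hf.w_pos
      rw [← hm, ← hV] at hb
      have h4 := mul_le_mul_of_nonneg_left (hw z hz) (norm_nonneg (hTrans μ₃ (w₃ ζ) - (m : ℂ)))
      have h5 : ‖hTrans μ₃ (w₃ ζ) - (m : ℂ)‖ ≤ V / (3 / 4 * c) := by
        rw [le_div_iff₀ (by positivity)]; exact h4.trans hb
      have h6 := norm_add_le (m : ℂ) (hTrans μ₃ (w₃ ζ) - (m : ℂ))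
      rw [add_sub_cancel, Complex.norm_real, Real.norm_eq_abs] at h6
      linarith
    have e : cauchyF μ₃ (w₃ ζ) - z =
        (w₃ ζ - ζ) + (c : ℂ) * Complex.I - hTrans μ₃ (w₃ ζ) := by
      simp only [hTrans, hζ]; ring
    have b3 : ‖(c : ℂ) * Complex.I‖ = c := by simp [abs_of_pos cpos]
    rw [e]
    calc _ ≤ ‖(w₃ ζ - ζ) + (c : ℂ) * Complex.I‖ + ‖hTrans μ₃ (w₃ ζ)‖ := norm_sub_le _ _
      _ ≤ ‖w₃ ζ - ζ‖ + ‖(c : ℂ) * Complex.I‖ + ‖hTrans μ₃ (w₃ ζ)‖ := by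
        gcongr; exact norm_add_le _ _
      _ ≤ _ := by rw [b3]; gcongr
  have dpos : 0 < 3 / 4 * c := by positivity
  refine ⟨hdiff, fun z hz => dpos.trans_le (hlow z hz), ?_, ?_⟩
  · rw [tendsto_iff_norm_sub_tendsto_zero]
    have t0 : Tendsto (fun y : ℝ => B * y⁻¹) atTop (nhds 0) := by
      simpa using tendsto_inv_atTop_zero.const_mul B
    refine squeeze_zero' (Eventually.of_forall fun _ => norm_nonneg _) ?_ t0
    filter_upwards [eventually_gt_atTop 0] with y hy
    have hy' : (Complex.I * (y : ℂ)) ≠ 0 :=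
      mul_ne_zero Complex.I_ne_zero (Complex.ofReal_ne_zero.2 hy.ne')
    rw [div_sub_one hy', norm_div]
    have n : ‖Complex.I * (y : ℂ)‖ = y := by simp [abs_of_pos hy]
    rw [n, div_eq_mul_inv]
    have := hB (Complex.I * y) (by simpa using hy)
    gcongr
  · exact rep_measure (fun z : ℂ => cauchyF μ₃ (w₃ (z + (c : ℂ) * Complex.I))) B (3 / 4 * c)
      dpos hdiff hB hlow
end

section
/- Let a ∈ A be selfadjoint and let b ∈ B be such that Im b is positive and invertible, with ε := inf(spectrum of Im b) > 0. Assume b − a is invertible in A and that G(b) := E((b − a)⁻¹) is invertible in B. Then ‖b − G(b)⁻¹ − E(a)‖ ≤ 4·‖E(a²) − E(a)²‖/ε. -/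
open Filter

/-- The "imaginary part" `Im c = (c - c*)/(2i)` of an element of a complex C*-algebra. -/
noncomputable def imc {A : Type*} [CStarAlgebra A] (c : A) : A :=
  ((2 : ℂ) * Complex.I)⁻¹ • (c - star c)

/-- Let `E : A → B` be a conditional expectation onto a unital
C*-subalgebra `B` of `A`, `a ∈ A` selfadjoint, and `b ∈ B` with `Im b` positive and
invertible with `ε = inf spectrum(Im b) > 0`. If `b - a` is invertible in `A` and
`G(b) = E((b-a)⁻¹)` is invertible in `B`, then
`‖b - G(b)⁻¹ - E(a)‖ ≤ 4‖E(a²) - E(a)²‖/ε`. -/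
theorem operator_h_transform_bound
    {A : Type*} [CStarAlgebra A] [PartialOrder A] [StarOrderedRing A]
    (S : StarSubalgebra ℂ A) (hSclosed : IsClosed (S : Set A))
    (E : A →ₗ[ℂ] A)
    (hErange : ∀ x : A, E x ∈ S)
    (hEone : E 1 = 1)
    (hEpos : ∀ x : A, 0 ≤ x → 0 ≤ E x)
    (hEmod : ∀ b b' x : A, b ∈ S → b' ∈ S → E (b * x * b') = b * E x * b')
    (a : A) (ha : IsSelfAdjoint a)
    (b : A) (hb : b ∈ S)
    (hbpos : 0 ≤ imc b) (hbinv : IsUnit (imc b))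
    (ε : ℝ) (hε : ε = sInf (spectrum ℝ (imc b))) (hεpos : 0 < ε)
    (hba : IsUnit (b - a))
    (hG : ∃ c ∈ S, E (Ring.inverse (b - a)) * c = 1 ∧ c * E (Ring.inverse (b - a)) = 1) :
    ‖b - Ring.inverse (E (Ring.inverse (b - a))) - E a‖ ≤
      4 * ‖E (a * a) - E a * E a‖ / ε := by
  obtain ⟨c, hcS, hGc, hcG⟩ := hG
  have hstar : ∀ z : A, E (star z) = star (E z) := by
    intro z
    exact map_star (PositiveLinearMap.mk₀ E hEpos) z
  have hmodl : ∀ s z : A, s ∈ S → E (s * z) = s * E z := by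
    intro s z hs
    simpa using hEmod s 1 z hs S.one_mem
  have hmodr : ∀ s z : A, s ∈ S → E (z * s) = E z * s := by
    intro s z hs
    simpa using hEmod 1 s z S.one_mem hs
  have hES : ∀ s : A, s ∈ S → E s = s := by
    intro s hs
    simpa [hEone] using hmodl s 1 hs
  have hcinv : Ring.inverse (E (Ring.inverse (b - a))) = c :=
    Ring.inverse_unit (⟨E (Ring.inverse (b - a)), c, hGc, hcG⟩ : Aˣ)
  rw [hcinv]
  have hR : (b - a) * Ring.inverse (b - a) = 1 := Ring.mul_inverse_cancel _ hba
  generalize Ring.inverse (b - a) = R at *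
  have heS : E a ∈ S := hErange a
  have hes : star (E a) = E a := by rw [← hstar, ha.star_eq]
  generalize he : E a = e at *
  have hEe : E e = e := hES e heS
  have hk1 : E (R * c) = 1 := by rw [hmodr _ _ hcS, hGc]
  have hbk : (b - a) * (R * c) = c := by rw [← mul_assoc, hR, one_mul]
  generalize hk : R * c = k at *
  have hak : a * k = b * k - c := by
    rw [← hbk]; noncomm_ring
  have hbS : star b ∈ S := star_mem hb
  have hcS' : star c ∈ S := star_mem hcS
  set h := b - c - e with hh
  have hhS : h ∈ S := sub_mem (sub_mem hb hcS) heS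
  have hhS' : star h ∈ S := star_mem hhS
  have hk1' : E (star k) = 1 := by rw [hstar, hk1, star_one]
  have hxy : E ((a - e) * (k - 1)) = h := by
    have : (a - e) * (k - 1) = b * k - c - e * k - a + e := by
      rw [← hak]; noncomm_ring
    rw [this]
    simp only [map_sub, map_add, hmodl _ _ hb, hmodl _ _ heS, hES _ hcS, hk1, he, hEe, hh]
    noncomm_ring
  have hyx : E (star (k - 1) * (a - e)) = star h := by
    rw [← hxy, ← hstar, star_mul, star_sub a e, ha.star_eq, hes]
  have hV : E ((a - e) * (a - e)) = E (a * a) - e * e := by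
    have : (a - e) * (a - e) = a * a - e * a - a * e + e * e := by noncomm_ring
    rw [this]
    simp only [map_sub, map_add, hmodl _ _ heS, hmodr _ _ heS, he, hEe]
    noncomm_ring
  have hβ : E (star (k - 1) * (b - star b) * (k - 1)) = - (h - star h) := by
    have hak' : star k * a = star k * star b - star c := by
      have := congrArg star hak
      simpa [ha.star_eq] using this
    have : star (k - 1) * (b - star b) * (k - 1)
        = star k * c - star c * k - star k * (b - star b) - (b - star b) * k + (b - star b) := by
      have h1 : star k * b * k = star k * (a * k) + star k * c := by rw [hak]; noncomm_ring
      have h2 : star k * star b * k = (star k * a) * k + star c * k := by rw [hak']; noncomm_ring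
      have h3 : star (k - 1) * (b - star b) * (k - 1) = star k * b * k - star k * star b * k
         - star k * (b - star b) - (b - star b) * k + (b - star b) := by
        rw [star_sub, star_one]; noncomm_ring
      rw [h3, h1, h2]; noncomm_ring
    rw [this]
    have hβS : b - star b ∈ S := sub_mem hb hbS
    simp only [map_sub, map_add, hmodl _ _ hcS', hmodr _ _ hcS, hmodl _ _ hβS, hmodr _ _ hβS,
      hk1, hk1', hES _ hb, hES _ hbS, hh, star_sub, hes]
    noncomm_ring
  have hβ' : E (star (k - 1) * imc b * (k - 1)) = - imc h := by
    unfold imc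
    rw [mul_smul_comm, smul_mul_assoc, map_smul, hβ, smul_neg]
  have hεb : algebraMap ℝ A ε ≤ imc b := by
    have hsa : IsSelfAdjoint (imc b) := IsSelfAdjoint.of_nonneg hbpos
    rw [algebraMap_le_iff_le_spectrum (ha := hsa)]
    intro t ht
    rw [hε]
    exact csInf_le (spectrum.isCompact (𝕜 := ℝ) (imc b)).bddBelow ht
  have hεy : ε • E (star (k - 1) * (k - 1)) ≤ - imc h := by
    rw [← hβ']
    have h1 := star_left_conjugate_le_conjugate hεb (k - 1)
    have h2 := hEpos _ (sub_nonneg.2 h1)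
    rw [map_sub, sub_nonneg] at h2
    have h3 : star (k - 1) * algebraMap ℝ A ε * (k - 1) = (ε : ℂ) • (star (k - 1) * (k - 1)) := by
      rw [Algebra.algebraMap_eq_smul_one, mul_smul_comm, smul_mul_assoc, mul_one]
      exact (Complex.coe_smul ε _).symm
    rw [h3, map_smul, Complex.coe_smul] at h2
    exact h2
  have him : ‖imc h‖ ≤ ‖h‖ := by
    unfold imc
    rw [norm_smul]
    have h1 : ‖((2 : ℂ) * Complex.I)⁻¹‖ = 1 / 2 := by simp
    have h2 := norm_sub_le h (star h)
    rw [norm_star] at h2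
    rw [h1]; linarith
  have hVpos : 0 ≤ E ((a - e) * (a - e)) := by
    apply hEpos
    have := star_mul_self_nonneg (a - e)
    rwa [star_sub, ha.star_eq, hes] at this
  rw [← hV]
  set V := E ((a - e) * (a - e)) with hVdef
  have key : ∀ v : ℝ, ‖V‖ < v → ‖h‖ ≤ v / ε := by
    intro v hv
    have hv0 : 0 < v := lt_of_le_of_lt (norm_nonneg _) hv
    have h1 : 0 ≤ E (star ((v : ℂ) • (k - 1) - (a - e) * h) * ((v : ℂ) • (k - 1) - (a - e) * h)) :=
      hEpos _ (star_mul_self_nonneg _)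
    have h2 : star ((v : ℂ) • (k - 1) - (a - e) * h) * ((v : ℂ) • (k - 1) - (a - e) * h)
        = (v : ℂ) • (v : ℂ) • (star (k - 1) * (k - 1)) - (v : ℂ) • ((star (k - 1) * (a - e)) * h)
          - (v : ℂ) • (star h * ((a - e) * (k - 1))) + star h * ((a - e) * (a - e)) * h := by
      rw [star_sub, star_mul, star_sub a e, ha.star_eq, hes, star_smul]
      generalize k - 1 = y
      generalize a - e = x
      simp only [sub_mul, mul_sub, smul_mul_assoc, mul_smul_comm,
        RCLike.star_def, Complex.conj_ofReal, smul_sub, mul_assoc]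
      abel
    rw [h2] at h1
    simp only [map_sub, map_add, map_smul, hmodl _ _ hhS', hmodr _ _ hhS, hxy, hyx] at h1
    rw [← hVdef] at h1
    have h3 : star h * V * h ≤ v • (star h * h) := by
      have h4 : V ≤ algebraMap ℝ A v :=
        (IsSelfAdjoint.le_algebraMap_norm_self (IsSelfAdjoint.of_nonneg hVpos)).trans
          (algebraMap_mono A hv.le)
      have h5 := star_left_conjugate_le_conjugate h4 h
      rwa [Algebra.algebraMap_eq_smul_one, mul_smul_comm, smul_mul_assoc, mul_one] at h5
    simp only [Complex.coe_smul] at h1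
    have h6 : v • (star h * h) ≤ v • (v • E (star (k - 1) * (k - 1))) := by
      rw [← sub_nonneg]
      have := add_nonneg h1 (sub_nonneg.2 h3)
      convert this using 1
      abel
    have h7 : star h * h ≤ v • E (star (k - 1) * (k - 1)) := le_of_smul_le_smul_left h6 hv0
    have h8 : ε • (star h * h) ≤ v • (- imc h) := by
      calc ε • (star h * h) ≤ ε • (v • E (star (k - 1) * (k - 1))) :=
            smul_le_smul_of_nonneg_left h7 hεpos.le
        _ = v • (ε • E (star (k - 1) * (k - 1))) := smul_comm _ _ _
        _ ≤ _ := smul_le_smul_of_nonneg_left hεy hv0.le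
    have h9 := CStarAlgebra.norm_le_norm_of_nonneg_of_le
      (smul_nonneg hεpos.le (star_mul_self_nonneg h)) h8
    rw [norm_smul, norm_smul, norm_neg, CStarRing.norm_star_mul_self, Real.norm_of_nonneg hεpos.le,
      Real.norm_of_nonneg hv0.le] at h9
    rw [le_div_iff₀ hεpos]
    rcases (norm_nonneg h).eq_or_lt with h0 | h0
    · rw [← h0]; simpa using hv0.le
    · have h10 : ε * (‖h‖ * ‖h‖) ≤ v * ‖h‖ := h9.trans (mul_le_mul_of_nonneg_left him hv0.le)
      nlinarith
  have hfin : ‖h‖ * ε ≤ ‖V‖ := by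
    apply le_of_forall_gt_imp_ge_of_dense
    intro v hv
    exact (le_div_iff₀ hεpos).1 (key v hv)
  rw [le_div_iff₀ hεpos]
  have := norm_nonneg V
  linarith
end

section
/- Let a ∈ A be selfadjoint with ‖a‖ ≤ M, and let b ∈ B be invertible with ‖b‖ < 1/M and such that Im(b⁻¹) is positive and invertible. Assume b⁻¹ − a is invertible in A and that G(b⁻¹) := E((b⁻¹ − a)⁻¹) is invertible in B. Then ‖b⁻¹ − G(b⁻¹)⁻¹ − E(a)‖ ≤ ‖E(a²) − E(a)²‖/(‖b‖⁻¹ − M). -/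
open Filter

section helpers

variable {A : Type*} [CStarAlgebra A] [PartialOrder A] [StarOrderedRing A]
    (S : StarSubalgebra ℂ A) (E : A →ₗ[ℂ] A)

lemma hE_star (hEpos : ∀ x : A, 0 ≤ x → 0 ≤ E x) (x : A) : E (star x) = star (E x) :=
  map_star (PositiveLinearMap.mk₀ E hEpos) x

lemma hE_mono (hEpos : ∀ x : A, 0 ≤ x → 0 ≤ E x) {x y : A} (h : x ≤ y) : E x ≤ E y := by
  have := hEpos (y - x) (sub_nonneg.2 h)
  rw [map_sub] at this
  exact sub_nonneg.1 this

lemma hE_left (hEmod : ∀ b b' x : A, b ∈ S → b' ∈ S → E (b * x * b') = b * E x * b')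
    (c x : A) (hc : c ∈ S) : E (c * x) = c * E x := by
  simpa using hEmod c 1 x hc (one_mem S)

lemma hE_right (hEmod : ∀ b b' x : A, b ∈ S → b' ∈ S → E (b * x * b') = b * E x * b')
    (c x : A) (hc : c ∈ S) : E (x * c) = E x * c := by
  simpa using hEmod 1 c x (one_mem S) hc

lemma hE_real (r : ℝ) (x : A) : E (r • x) = r • E x := by
  have := E.map_smul (r : ℂ) x
  simpa using this

/-- module Cauchy-Schwarz -/
lemma hE_cs (hErange : ∀ x : A, E x ∈ S)
    (hEpos : ∀ x : A, 0 ≤ x → 0 ≤ E x)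
    (hEmod : ∀ b b' x : A, b ∈ S → b' ∈ S → E (b * x * b') = b * E x * b') (x y : A) :
    ‖E (star y * x)‖ ≤ √‖E (star y * y)‖ * √‖E (star x * x)‖ := by
  have key : ∀ N : ℝ, 0 < N → ‖E (star y * y)‖ ≤ N →
      ‖E (star y * x)‖ ^ 2 ≤ N * ‖E (star x * x)‖ := by
    intro N hN hle
    set e := E (star y * x) with he
    have heS : e ∈ S := hErange _
    have heS' : star e ∈ S := star_mem heS
    have he' : E (star x * y) = star e := by
      rw [he, ← hE_star E hEpos]; simp
    have hN0 : N ≠ 0 := hN.ne'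
    have h1 : 0 ≤ E (star (N • x - y * e) * (N • x - y * e)) := hEpos _ (star_mul_self_nonneg _)
    have h2 : E (star (N • x - y * e) * (N • x - y * e)) =
        (N * N) • E (star x * x) - (2 * N) • (star e * e) + star e * E (star y * y) * e := by
      have : star (N • x - y * e) * (N • x - y * e) = (N * N) • (star x * x)
          - N • ((star x * y) * e) - N • (star e * (star y * x)) + star e * (star y * y) * e := by
        simp only [star_sub, star_smul, star_mul, star_trivial, sub_mul, mul_sub, smul_mul_assoc,
          mul_smul_comm, smul_sub, smul_smul, mul_assoc]
        abel
      rw [this, map_add, map_sub, map_sub, hE_real, hE_real, hE_real,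
        hE_right S E hEmod _ _ heS, hE_left S E hEmod _ _ heS', hEmod _ _ _ heS' heS, he', ← he,
        two_mul, add_smul]
      abel
    have h3 : star e * E (star y * y) * e ≤ N • (star e * e) := by
      refine (CStarAlgebra.star_left_conjugate_le_norm_smul
        (IsSelfAdjoint.of_nonneg (hEpos _ (star_mul_self_nonneg y)))).trans ?_
      exact smul_le_smul_of_nonneg_right hle (star_mul_self_nonneg e)
    have h4 : N • (star e * e) ≤ (N * N) • E (star x * x) := by
      rw [h2] at h1
      have h5 := h1.trans (add_le_add_right h3 _)
      rw [← sub_nonneg]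
      refine h5.trans (le_of_eq ?_)
      rw [two_mul, add_smul]; abel
    have h6 := CStarAlgebra.norm_le_norm_of_nonneg_of_le
      (smul_nonneg hN.le (star_mul_self_nonneg e)) h4
    rw [norm_smul, norm_smul, CStarRing.norm_star_mul_self, Real.norm_of_nonneg hN.le,
      Real.norm_of_nonneg (by positivity), mul_assoc] at h6
    have := le_of_mul_le_mul_left h6 hN
    nlinarith
  have : ‖E (star y * x)‖ ^ 2 ≤ ‖E (star y * y)‖ * ‖E (star x * x)‖ := by
    refine le_of_tendsto_of_tendsto' (f := fun _ : ℕ => ‖E (star y * x)‖ ^ 2)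
      (g := fun n : ℕ => (‖E (star y * y)‖ + 1 / ((n : ℝ) + 1)) * ‖E (star x * x)‖)
      (b := Filter.atTop) tendsto_const_nhds ?_ ?_
    · have := (tendsto_one_div_add_atTop_nhds_zero_nat (𝕜 := ℝ)).const_add ‖E (star y * y)‖
      simpa using this.mul_const ‖E (star x * x)‖
    · intro n
      exact key _ (by positivity) (le_add_of_nonneg_right (by positivity))
  rw [← Real.sqrt_mul (norm_nonneg _)]
  exact Real.le_sqrt_of_sq_le this

lemma hE_tri (hErange : ∀ x : A, E x ∈ S)
    (hEpos : ∀ x : A, 0 ≤ x → 0 ≤ E x)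
    (hEmod : ∀ b b' x : A, b ∈ S → b' ∈ S → E (b * x * b') = b * E x * b') (x y : A) :
    √‖E (star (x + y) * (x + y))‖ ≤ √‖E (star x * x)‖ + √‖E (star y * y)‖ := by
  have h1 := hE_cs S E hErange hEpos hEmod x y
  have h2 := hE_cs S E hErange hEpos hEmod y x
  have h3 : E (star (x + y) * (x + y)) =
      E (star x * x) + E (star x * y) + (E (star y * x) + E (star y * y)) := by
    rw [star_add, add_mul, mul_add, mul_add, map_add, map_add, map_add]
  rw [h3]
  refine Real.sqrt_le_iff.2 ⟨by positivity, ?_⟩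
  have h4 := norm_add_le (E (star x * x) + E (star x * y)) (E (star y * x) + E (star y * y))
  have h5 := norm_add_le (E (star x * x)) (E (star x * y))
  have h6 := norm_add_le (E (star y * x)) (E (star y * y))
  nlinarith [Real.sq_sqrt (norm_nonneg (E (star x * x))),
    Real.sq_sqrt (norm_nonneg (E (star y * y)))]

lemma hE_mul (hEpos : ∀ x : A, 0 ≤ x → 0 ≤ E x) (m x : A) :
    √‖E (star (m * x) * (m * x))‖ ≤ ‖m‖ * √‖E (star x * x)‖ := by
  have h : star (m * x) * (m * x) ≤ (‖m‖ * ‖m‖) • (star x * x) := by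
    have := CStarAlgebra.star_left_conjugate_le_norm_smul (a := x)
      (IsSelfAdjoint.star_mul_self m)
    rw [CStarRing.norm_star_mul_self] at this
    simpa [mul_assoc] using this
  have h2 := CStarAlgebra.norm_le_norm_of_nonneg_of_le (hEpos _ (star_mul_self_nonneg _))
    (hE_mono E hEpos h)
  rw [hE_real, norm_smul, Real.norm_of_nonneg (by positivity)] at h2
  refine (Real.sqrt_le_sqrt h2).trans ?_
  rw [Real.sqrt_mul (by positivity), Real.sqrt_mul_self (norm_nonneg _)]

lemma hE_var (hErange : ∀ x : A, E x ∈ S)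
    (hEone : E 1 = 1)
    (hEpos : ∀ x : A, 0 ≤ x → 0 ≤ E x)
    (hEmod : ∀ b b' x : A, b ∈ S → b' ∈ S → E (b * x * b') = b * E x * b') (x : A) :
    E (star (x - E x) * (x - E x)) = E (star x * x) - star (E x) * E x := by
  have hs : star (E x) ∈ S := star_mem (hErange x)
  have hid : E (E x) = E x := by
    have := hE_right S E hEmod (E x) 1 (hErange x)
    simpa [hEone] using this
  rw [star_sub, sub_mul, mul_sub, mul_sub, map_sub, map_sub, map_sub,
    hE_right S E hEmod _ _ (hErange x), hE_left S E hEmod _ _ hs, hE_left S E hEmod _ _ hs, hid,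
    hE_star E hEpos]
  abel

lemma hE_proj (hErange : ∀ x : A, E x ∈ S)
    (hEone : E 1 = 1)
    (hEpos : ∀ x : A, 0 ≤ x → 0 ≤ E x)
    (hEmod : ∀ b b' x : A, b ∈ S → b' ∈ S → E (b * x * b') = b * E x * b') (x : A) :
    √‖E (star (x - E x) * (x - E x))‖ ≤ √‖E (star x * x)‖ := by
  refine Real.sqrt_le_sqrt (CStarAlgebra.norm_le_norm_of_nonneg_of_le
    (hEpos _ (star_mul_self_nonneg _)) ?_)
  rw [hE_var S E hErange hEone hEpos hEmod]
  exact sub_le_self _ (star_mul_self_nonneg _)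

end helpers

/-- Let `E : A → B` be a conditional expectation onto a unital
C*-subalgebra `B` of `A`, `a ∈ A` selfadjoint with `‖a‖ ≤ M`, and `b ∈ B` invertible
with `‖b‖ < 1/M` and `Im(b⁻¹)` positive and invertible. If `b⁻¹ - a` is invertible in
`A` and `G(b⁻¹) = E((b⁻¹-a)⁻¹)` is invertible in `B`, then
`‖b⁻¹ - G(b⁻¹)⁻¹ - E(a)‖ ≤ ‖E(a²) - E(a)²‖/(‖b‖⁻¹ - M)`. -/
theorem operator_H_transform_bound
    {A : Type*} [CStarAlgebra A] [PartialOrder A] [StarOrderedRing A]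
    (S : StarSubalgebra ℂ A) (hSclosed : IsClosed (S : Set A))
    (E : A →ₗ[ℂ] A)
    (hErange : ∀ x : A, E x ∈ S)
    (hEone : E 1 = 1)
    (hEpos : ∀ x : A, 0 ≤ x → 0 ≤ E x)
    (hEmod : ∀ b b' x : A, b ∈ S → b' ∈ S → E (b * x * b') = b * E x * b')
    (a : A) (ha : IsSelfAdjoint a)
    (M : ℝ) (hM : 0 < M) (haM : ‖a‖ ≤ M)
    (b : A) (hb : b ∈ S) (hbunit : IsUnit b) (hbnorm : ‖b‖ < 1 / M)
    (hbpos : 0 ≤ imc (Ring.inverse b)) (hbinv : IsUnit (imc (Ring.inverse b)))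
    (hba : IsUnit (Ring.inverse b - a))
    (hG : ∃ c ∈ S, E (Ring.inverse (Ring.inverse b - a)) * c = 1 ∧
      c * E (Ring.inverse (Ring.inverse b - a)) = 1) :
    ‖Ring.inverse b - Ring.inverse (E (Ring.inverse (Ring.inverse b - a))) - E a‖ ≤
      ‖E (a * a) - E a * E a‖ / (‖b‖⁻¹ - M) := by
  obtain ⟨c, hcS, hGc, hcG⟩ := hG
  rcases subsingleton_or_nontrivial A with hA | hA
  · have h1 : ∀ x : A, ‖x‖ = 0 := fun x => by rw [Subsingleton.elim x 0, norm_zero]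
    rw [h1, h1, zero_div]
  have hb0 : 0 < ‖b‖ := norm_pos_iff.2 hbunit.ne_zero
  set w := Ring.inverse b with hw
  set R := Ring.inverse (w - a) with hR
  have hbw : b * w = 1 := Ring.mul_inverse_cancel b hbunit
  have hwR : (w - a) * R = 1 := Ring.mul_inverse_cancel _ hba
  have hGinv : Ring.inverse (E R) = c := by
    have hu : IsUnit (E R) := ⟨⟨E R, c, hGc, hcG⟩, rfl⟩
    calc Ring.inverse (E R) = Ring.inverse (E R) * (E R * c) := by rw [hGc, mul_one]
      _ = c := by rw [← mul_assoc, Ring.inverse_mul_cancel _ hu, one_mul]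
  rw [hGinv]
  set z := R * c - 1 with hz
  have hEz : E z = 0 := by
    rw [hz, map_sub, hE_right S E hEmod _ _ hcS, hGc, hEone, sub_self]
  -- `b * (w z) = z`
  have hwz0 : w * z = a * z + a + c - w := by
    have : (w - a) * z = c - (w - a) := by
      rw [hz, mul_sub, ← mul_assoc, hwR, one_mul, mul_one]
    rw [sub_mul] at this
    rw [eq_add_of_sub_eq this]; abel
  have hz0 : z = b * (a * z + a + c - w) := by rw [← hwz0, ← mul_assoc, hbw, one_mul]
  have hEc : E c = c := by simpa [hEone] using hE_right S E hEmod c 1 hcS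
  have hbE : b * (E (a * z) + E a + c) = 1 := by
    have h1 : z = b * (a * z + a + c) - 1 := by
      rw [← hbw, ← mul_sub]; exact hz0
    have h2 := congrArg E h1
    rw [hEz, map_sub, hE_left S E hEmod _ _ hb, map_add, map_add, hEone, hEc] at h2
    exact (sub_eq_zero.1 h2.symm)
  have hwb : w * b = 1 := Ring.inverse_mul_cancel b hbunit
  have hw2 : w = E (a * z) + E a + c := by
    calc w = w * (b * (E (a * z) + E a + c)) := by rw [hbE, mul_one]
      _ = _ := by rw [← mul_assoc, hwb, one_mul]
  have hgoal : w - c - E a = E (star (a - E a) * z) := by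
    have hsa : star (E a) = E a := by rw [← hE_star E hEpos, ha.star_eq]
    rw [star_sub, ha.star_eq, hsa, sub_mul, map_sub, hE_left S E hEmod _ _ (hErange a), hEz,
      mul_zero, sub_zero]
    nth_rw 1 [hw2]
    abel
  have hz1 : z = b * ((a - E a) + (a * z - E (a * z))) := by
    nth_rw 1 [hz0]
    congr 1
    nth_rw 1 [hw2]
    abel
  have hvar : E (star (a - E a) * (a - E a)) = E (a * a) - E a * E a := by
    rw [hE_var S E hErange hEone hEpos hEmod, ← hE_star E hEpos, ha.star_eq]
  set p := √‖E (star (a - E a) * (a - E a))‖ with hp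
  set q := √‖E (star z * z)‖ with hq
  have hpp : p * p = ‖E (a * a) - E a * E a‖ := by
    rw [hp, Real.mul_self_sqrt (norm_nonneg _), hvar]
  have hp0 : 0 ≤ p := Real.sqrt_nonneg _
  have hq0 : 0 ≤ q := Real.sqrt_nonneg _
  have hqle : q ≤ ‖b‖ * (p + M * q) := by
    have h1 := hE_mul E hEpos b ((a - E a) + (a * z - E (a * z)))
    rw [← hz1] at h1
    refine h1.trans (mul_le_mul_of_nonneg_left ?_ hb0.le)
    refine (hE_tri S E hErange hEpos hEmod _ _).trans (add_le_add le_rfl ?_)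
    refine (hE_proj S E hErange hEone hEpos hEmod _).trans ?_
    exact (hE_mul E hEpos a z).trans (mul_le_mul_of_nonneg_right haM hq0)
  have hd : 0 < ‖b‖⁻¹ - M := by
    rw [sub_pos]
    rw [one_div] at hbnorm
    exact (lt_inv_comm₀ hb0 hM).1 hbnorm
  rw [le_div_iff₀ hd, hgoal, ← hpp]
  have hcs := hE_cs S E hErange hEpos hEmod z (a - E a)
  have hq2 : q * (‖b‖⁻¹ - M) ≤ p := by
    have : ‖b‖⁻¹ * q ≤ p + M * q := by
      rw [inv_mul_le_iff₀ hb0]; exact hqle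
    linarith
  calc _ ≤ (p * q) * (‖b‖⁻¹ - M) := mul_le_mul_of_nonneg_right hcs hd.le
    _ = p * (q * (‖b‖⁻¹ - M)) := by ring
    _ ≤ p * p := mul_le_mul_of_nonneg_left hq2 hp0
end
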